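/- arXiv:2601.09447 — 3 statements merged into one kernel-verified Lean document; each statement's English description precedes it below -/
import Mathlib

section
/- (Heydari–Sudborough / Cibulka) For every integer n ≥ 23 with n ≡ 3 (mod 4), the minimum number of flips needed to sort the burnt stack Ī_n = [-1, -2, ..., -n] into I_n = [1, 2, ..., n] equals (3n+3)/2, i.e., T(n) = (3n+3)/2. -/
/-- The flip of the top `k` pancakes of a burnt pancake stack `l`. -/
def pancakeFlip (k : ℕ) (l : List ℤ) : List ℤ :=
  ((l.take k).map Neg.neg).reverse ++ l.drop k

/-- Apply a sequence of flips (given by their sizes) successively to a stack. -/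
def applyFlips (ks : List ℕ) (l : List ℤ) : List ℤ :=
  ks.foldl (fun s k => pancakeFlip k s) l

/-- The sorted stack `I_n = [1, 2, ..., n]`. -/
def sortedStack (n : ℕ) : List ℤ := (List.range n).map (fun i => (i : ℤ) + 1)

/-- The reversed burnt stack `Ī_n = [-1, -2, ..., -n]`. -/
def burntStack (n : ℕ) : List ℤ := (List.range n).map (fun i => -((i : ℤ) + 1))

/-- A sequence of flips, each of size between `1` and `n`, transforming `Ī_n` into `I_n`. -/
def IsSortingSeq (n : ℕ) (ks : List ℕ) : Prop :=
  (∀ k ∈ ks, 1 ≤ k ∧ k ≤ n) ∧ applyFlips ks (burntStack n) = sortedStack n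

/-- `T n` is the minimum number of flips transforming `Ī_n` into `I_n`. -/
noncomputable def T (n : ℕ) : ℕ :=
  sInf {m | ∃ ks : List ℕ, IsSortingSeq n ks ∧ ks.length = m}

/-- Turn a list of signed pancakes upside down as one block. -/
def negReverse (l : List ℤ) : List ℤ := (l.map Neg.neg).reverse

@[simp] theorem negReverse_nil : negReverse [] = [] := rfl

@[simp] theorem negReverse_cons (a : ℤ) (l : List ℤ) :
    negReverse (a :: l) = negReverse l ++ [-a] := by simp [negReverse]

@[simp] theorem negReverse_append (l m : List ℤ) :
    negReverse (l ++ m) = negReverse m ++ negReverse l := by simp [negReverse]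

@[simp] theorem negReverse_negReverse (l : List ℤ) : negReverse (negReverse l) = l := by
  simp [negReverse]

@[simp] theorem length_negReverse (l : List ℤ) : (negReverse l).length = l.length := by
  simp [negReverse]

theorem sortedStack_eq_map (n : ℕ) :
    sortedStack n = (List.range n).map fun i : ℕ => (i : ℤ) + 1 := by
  simp only [sortedStack, bind, pure, List.map_flatMap, List.map_cons, List.map_nil]
  exact List.map_eq_flatMap.symm

theorem burntStack_eq_map (n : ℕ) :
    burntStack n = (List.range n).map fun i : ℕ => -((i : ℤ) + 1) := by
  simp only [burntStack, bind, pure, List.map_flatMap, List.map_cons, List.map_nil]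
  exact List.map_eq_flatMap.symm

theorem applyFlips_nil (l : List ℤ) : applyFlips [] l = l := rfl

theorem applyFlips_cons (k : ℕ) (ks : List ℕ) (l : List ℤ) :
    applyFlips (k :: ks) l = applyFlips ks (pancakeFlip k l) := rfl

theorem applyFlips_append (ks ms : List ℕ) (l : List ℤ) :
    applyFlips (ks ++ ms) l = applyFlips ms (applyFlips ks l) := by
  simp [applyFlips]

theorem pancakeFlip_append (k : ℕ) (p q : List ℤ) (h : p.length = k) :
    pancakeFlip k (p ++ q) = negReverse p ++ q := by
  subst h
  simp [pancakeFlip, negReverse]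

theorem pancakeFlip_of_eq_append {k : ℕ} {l : List ℤ} (p q : List ℤ) (h : l = p ++ q)
    (hk : p.length = k) : pancakeFlip k l = negReverse p ++ q := by
  rw [h, pancakeFlip_append k p q hk]

theorem applyFlips_cons_of_eq_append {k : ℕ} {ks : List ℕ} {l : List ℤ} (p q : List ℤ)
    (h : l = p ++ q) (hk : p.length = k) :
    applyFlips (k :: ks) l = applyFlips ks (negReverse p ++ q) := by
  rw [applyFlips_cons, pancakeFlip_of_eq_append p q h hk]

theorem pancakeFlip_pancakeFlip (k : ℕ) (l : List ℤ) : pancakeFlip k (pancakeFlip k l) = l := by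
  obtain h | h := le_total k l.length
  · have hl : (l.take k).length = k := by simp [h]
    conv_rhs => rw [← List.take_append_drop k l]
    rw [pancakeFlip_of_eq_append (l := l) _ _ (List.take_append_drop k l).symm hl,
      pancakeFlip_append _ _ _ (by simp [h]), negReverse_negReverse]
  · simp [pancakeFlip, List.take_of_length_le, List.drop_of_length_le, h]

theorem applyFlips_reverse_applyFlips (ks : List ℕ) (l : List ℤ) :
    applyFlips ks.reverse (applyFlips ks l) = l := by
  induction ks generalizing l with
  | nil => rfl
  | cons k ks ih =>
    rw [applyFlips_cons, List.reverse_cons, applyFlips_append, ih, applyFlips_cons, applyFlips_nil,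
      pancakeFlip_pancakeFlip]

theorem map_negReverse {f : ℤ → ℤ} (hf : ∀ v, f (-v) = -f v) (l : List ℤ) :
    (negReverse l).map f = negReverse (l.map f) := by
  simp [negReverse, Function.comp_def, hf]

theorem map_applyFlips {f : ℤ → ℤ} (hf : ∀ v, f (-v) = -f v) (ks : List ℕ) (l : List ℤ) :
    (applyFlips ks l).map f = applyFlips ks (l.map f) := by
  induction ks generalizing l with
  | nil => rfl
  | cons k ks ih =>
    rw [applyFlips_cons, ih, applyFlips_cons]
    simp [pancakeFlip, Function.comp_def, hf]

/-- The relabelling `v ↦ c - v` of positive labels, extended to an odd function. -/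
def complement (c v : ℤ) : ℤ := if 0 < v then c - v else if v < 0 then -c - v else 0

theorem complement_neg (c v : ℤ) : complement c (-v) = -complement c v := by
  unfold complement
  split_ifs <;> omega

theorem map_complement_sortedStack (n : ℕ) :
    (sortedStack n).map (complement (n + 1)) = negReverse (burntStack n) := by
  apply List.ext_getElem
  · simp [sortedStack_eq_map, burntStack_eq_map]
  · intro i h₁ h₂
    simp [sortedStack_eq_map] at h₁
    simp [sortedStack_eq_map, burntStack_eq_map, negReverse, complement]
    omega

theorem map_complement_map_complement {c : ℤ} {l : List ℤ} (h : ∀ v ∈ l, 0 < |v| ∧ |v| < c) :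
    (l.map (complement c)).map (complement c) = l := by
  rw [List.map_map]
  conv_rhs => rw [← List.map_id l]
  refine List.map_congr_left fun v hv => ?_
  obtain ⟨h₁, h₂⟩ := h v hv
  have h₃ := abs_lt.1 h₂
  have h₄ := abs_pos.1 h₁
  simp only [Function.comp_apply, complement, id]
  split_ifs <;> omega

theorem isSortingSeq_of_symmetric {n : ℕ} (hn : 2 ≤ n) {ks : List ℕ}
    (hks : ∀ k ∈ ks, 1 ≤ k ∧ k ≤ n)
    (h : pancakeFlip (n - 1) (applyFlips ks (negReverse (burntStack n))) =
      (applyFlips ks (negReverse (burntStack n))).map (complement (n + 1))) :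
    IsSortingSeq n (n :: ks ++ (n - 1) :: ks.reverse) := by
  refine ⟨?_, ?_⟩
  · simp only [List.mem_append, List.mem_cons, List.mem_reverse]
    rintro k ((rfl | hk) | rfl | hk)
    · omega
    · exact hks k hk
    · omega
    · exact hks k hk
  · have hsorted : ((sortedStack n).map (complement (n + 1))).map (complement (n + 1)) =
        sortedStack n := by
      refine map_complement_map_complement fun v hv => ?_
      simp only [sortedStack_eq_map, List.mem_map, List.mem_range] at hv
      obtain ⟨i, hi, rfl⟩ := hv
      rw [abs_of_pos (by omega)]
      omega
    have hflip : pancakeFlip n (burntStack n) = negReverse (burntStack n) := by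
      simpa using pancakeFlip_append n (burntStack n) [] (by simp [burntStack_eq_map])
    rw [applyFlips_append, applyFlips_cons, applyFlips_cons, hflip, h,
      map_applyFlips (complement_neg _), ← map_complement_sortedStack, hsorted,
      applyFlips_reverse_applyFlips]

/-- The block `-a, -(a + 1), …` of `m` consecutive labels. -/
def burntRun (a : ℤ) (m : ℕ) : List ℤ := (List.range m).map fun i : ℕ => -(a + (i : ℤ))

@[simp] theorem length_burntRun (a : ℤ) (m : ℕ) : (burntRun a m).length = m := by simp [burntRun]

theorem burntRun_add (a : ℤ) (m k : ℕ) :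
    burntRun a (m + k) = burntRun a m ++ burntRun (a + m) k := by
  simp [burntRun, List.range_add, Function.comp_def, add_assoc]

theorem burntStack_eq_burntRun (n : ℕ) : burntStack n = burntRun 1 n := by
  simp [burntRun, burntStack_eq_map, add_comm]

/-- The flips that unwind a run of `8 * r + 6` consecutive labels around its centre. -/
def unwindFlips : ℕ → List ℕ
  | 0 => []
  | r + 1 => [8 * r + 10, 8 * r + 8, 8 * r + 12, 8 * r + 10] ++ unwindFlips r

/-- The labels, unwound by `unwindFlips r`, surrounding the centre `s` of a run. -/
def unwound (s : ℤ) : ℕ → List ℤ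
  | 0 => []
  | r + 1 => unwound s r ++ [s - 4 * r - 3, s - 4 * r - 4, -(s + 4 * r + 6), -(s + 4 * r + 7),
      s - 4 * r - 1, s - 4 * r - 2, -(s + 4 * r + 8), -(s + 4 * r + 9)]

theorem length_unwound (s : ℤ) (r : ℕ) : (unwound s r).length = 8 * r := by
  induction r with
  | zero => rfl
  | succ r ih => simp [unwound, ih]; omega

theorem applyFlips_unwind_step {k : ℕ} {m : List ℤ} (hm : m.length + 4 = k + 2)
    (x₁ x₂ y₁ y₂ z₁ z₂ : ℤ) (q : List ℤ) :
    applyFlips [k + 2, k, k + 4, k + 2] ([x₁, x₂, y₁, y₂] ++ m ++ [z₁, z₂] ++ q) =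
      m ++ [-x₂, -x₁, z₁, z₂, -y₂, -y₁] ++ q := by
  rw [applyFlips_cons_of_eq_append ([x₁, x₂, y₁, y₂] ++ m) ([z₁, z₂] ++ q) (by simp)
      (by simp; omega),
    applyFlips_cons_of_eq_append (negReverse m ++ [-y₂, -y₁]) ([-x₂, -x₁, z₁, z₂] ++ q) (by simp)
      (by simp; omega),
    applyFlips_cons_of_eq_append ([y₁, y₂] ++ m ++ [-x₂, -x₁, z₁, z₂]) q (by simp)
      (by simp; omega),
    applyFlips_cons_of_eq_append ([-z₂, -z₁, x₁, x₂] ++ negReverse m) ([-y₂, -y₁] ++ q) (by simp)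
      (by simp; omega), applyFlips_nil]
  simp

theorem applyFlips_unwindFlips (s : ℤ) (r : ℕ) (q : List ℤ) :
    applyFlips (unwindFlips r) (burntRun (s - 4 * r) (8 * r + 6) ++ q) =
      burntRun s 6 ++ unwound s r ++ q := by
  induction r generalizing q with
  | zero => simp [unwindFlips, unwound, applyFlips_nil]
  | succ r ih =>
    have hsplit : burntRun (s - 4 * (r + 1 : ℕ)) (8 * (r + 1) + 6) =
        [-(s - 4 * r - 4), -(s - 4 * r - 3), -(s - 4 * r - 2), -(s - 4 * r - 1)] ++
          burntRun (s - 4 * r) (8 * r + 6) ++ [-(s + 4 * r + 6), -(s + 4 * r + 7)] ++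
          [-(s + 4 * r + 8), -(s + 4 * r + 9)] := by
      rw [show 8 * (r + 1) + 6 = 4 + (8 * r + 6) + 2 + 2 by ring, burntRun_add, burntRun_add,
        burntRun_add]
      congr 1
      · congr 1
        · congr 1
          · simp [burntRun, List.range_succ]
            omega
          · congr 1
            push_cast
            ring
        · simp [burntRun, List.range_succ]
          omega
      · simp [burntRun, List.range_succ]
        omega
    rw [unwindFlips, applyFlips_append, hsplit, List.append_assoc _ _ q,
      applyFlips_unwind_step (by simp), List.append_assoc, ih]
    simp [unwound]

/-- The flips that pull every other block of four labels to the top, for `r` blocks below a prefix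
of length `p`. -/
def pullFlips (p : ℕ) : ℕ → List ℕ
  | 0 => []
  | r + 1 => [p + 8 * r + 2, p + 8 * r + 6] ++ pullFlips (p + 4) r

/-- The labels of `unwound s r`, in the grouping relevant for `pullFlips`. -/
def pullable (s : ℤ) : ℕ → List ℤ
  | 0 => []
  | r + 1 => pullable s r ++ [-(s + 4 * r + 5), s - 4 * r - 3, s - 4 * r - 4, -(s + 4 * r + 6),
      -(s + 4 * r + 7), s - 4 * r - 1, s - 4 * r - 2, -(s + 4 * r + 8)]

/-- The labels pulled to the top by `pullFlips`. -/
def pulled (s : ℤ) : ℕ → List ℤ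
  | 0 => []
  | r + 1 => pulled s r ++ [-(s - 4 * r - 1), s + 4 * r + 7, s + 4 * r + 6, -(s - 4 * r - 4)]

/-- The labels left in place by `pullFlips`. -/
def unpulled (s : ℤ) : ℕ → List ℤ
  | 0 => []
  | r + 1 => unpulled s r ++ [-(s + 4 * r + 5), s - 4 * r - 3, s - 4 * r - 2, -(s + 4 * r + 8)]

theorem length_pullable (s : ℤ) (r : ℕ) : (pullable s r).length = 8 * r := by
  induction r with
  | zero => rfl
  | succ r ih => simp [pullable, ih]; omega

theorem length_pulled (s : ℤ) (r : ℕ) : (pulled s r).length = 4 * r := by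
  induction r with
  | zero => rfl
  | succ r ih => simp [pulled, ih]; omega

theorem length_unpulled (s : ℤ) (r : ℕ) : (unpulled s r).length = 4 * r := by
  induction r with
  | zero => rfl
  | succ r ih => simp [unpulled, ih]; omega

theorem cons_unwound (s : ℤ) (r : ℕ) :
    -(s + 5) :: unwound s r = pullable s r ++ [-(s + 4 * r + 5)] := by
  induction r with
  | zero => simp [unwound, pullable]
  | succ r ih =>
    rw [unwound, ← List.cons_append, ih, pullable]
    simp
    omega

theorem applyFlips_pullFlips (s : ℤ) {p : ℕ} {l : List ℤ} (hl : l.length = p) (r : ℕ)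
    (q : List ℤ) :
    applyFlips (pullFlips p r) (l ++ pullable s r ++ q) =
      pulled s r ++ l ++ unpulled s r ++ q := by
  induction r generalizing p l q with
  | zero => simp [pullFlips, pullable, pulled, unpulled, applyFlips_nil]
  | succ r ih =>
    rw [pullFlips, applyFlips_append,
      applyFlips_cons_of_eq_append (l ++ pullable s r ++ [-(s + 4 * r + 5), s - 4 * r - 3])
        ([s - 4 * r - 4, -(s + 4 * r + 6), -(s + 4 * r + 7), s - 4 * r - 1, s - 4 * r - 2,
          -(s + 4 * r + 8)] ++ q) (by simp [pullable]) (by simp [length_pullable, hl]; omega),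
      applyFlips_cons_of_eq_append
        (negReverse (l ++ pullable s r ++ [-(s + 4 * r + 5), s - 4 * r - 3]) ++
          [s - 4 * r - 4, -(s + 4 * r + 6), -(s + 4 * r + 7), s - 4 * r - 1])
        ([s - 4 * r - 2, -(s + 4 * r + 8)] ++ q) (by simp)
        (by simp [length_pullable, hl]; omega), applyFlips_nil]
    have := ih (p := p + 4)
      (l := [-(s - 4 * r - 1), s + 4 * r + 7, s + 4 * r + 6, -(s - 4 * r - 4)] ++ l)
      (by simp [hl])
      ([-(s + 4 * r + 5), s - 4 * r - 3, s - 4 * r - 2, -(s + 4 * r + 8)] ++ q)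
    simpa [pulled, unpulled] using this

theorem map_complement_pulled {c s : ℤ} (hc : c = 2 * s + 4) {r : ℕ} (hr : 4 * (r : ℤ) < s) :
    (pulled s r).map (complement c) = unpulled s r := by
  induction r with
  | zero => rfl
  | succ r ih =>
    push_cast at hr
    rw [pulled, unpulled, List.map_append, ih (by omega)]
    simp only [List.map_cons, List.map_nil, complement]
    congr 2
    · split_ifs <;> omega
    · congr 1
      · split_ifs <;> omega
      · congr 1
        · split_ifs <;> omega
        · congr 1
          split_ifs <;> omega

theorem map_complement_unpulled {c s : ℤ} (hc : c = 2 * s + 4) {r : ℕ} (hr : 4 * (r : ℤ) < s) :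
    (unpulled s r).map (complement c) = pulled s r := by
  induction r with
  | zero => rfl
  | succ r ih =>
    push_cast at hr
    rw [pulled, unpulled, List.map_append, ih (by omega)]
    simp only [List.map_cons, List.map_nil, complement]
    congr 2
    · split_ifs <;> omega
    · congr 1
      · split_ifs <;> omega
      · congr 1
        · split_ifs <;> omega
        · congr 1
          split_ifs <;> omega

theorem applyFlips_odd_turn {r : ℕ} {l : List ℤ} (hl : l.length = 8 * r)
    (a₁ a₂ a₃ a₄ a₅ a₆ b₁ b₂ b₃ b₄ b₅ b₆ b₇ b₈ b₉ : ℤ) :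
    applyFlips [4, 8 * r + 6, 8 * r + 14, 6, 4, 10, 8 * r + 15, 8 * r + 10, 4]
      ([a₁, a₂, a₃, a₄, a₅, a₆] ++ l ++ [b₁, b₂, b₃, b₄, b₅, b₆, b₇, b₈, b₉]) =
      [-b₅, -b₄, -b₃, b₇, b₆, -a₂, -a₁, a₅, a₆] ++ l ++ [b₉, b₈, -b₂, -b₁, -a₄, -a₃] := by
  simp [applyFlips, pancakeFlip, List.take_append, List.drop_append, hl, List.take_of_length_le,
    List.drop_of_length_le]

theorem applyFlips_even_turn {r : ℕ} {l : List ℤ} (hl : l.length = 8 * r)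
    (a₁ a₂ a₃ a₄ a₅ a₆ b₁ b₂ b₃ b₄ b₅ b₆ b₇ b₈ b₉ b₁₀ b₁₁ b₁₂ b₁₃ b₁₄ b₁₅ b₁₆ b₁₇ b₁₈ b₁₉ b₂₀
      b₂₁ : ℤ) :
    applyFlips [8 * r + 18, 8 * r + 26, 6, 4, 12, 8 * r + 14, 8 * r + 22, 6, 4, 10, 8 * r + 27,
      8 * r + 12, 4, 8 * r + 8, 8 * r + 22, 4]
      ([a₁, a₂, a₃, a₄, a₅, a₆] ++ l ++ [b₁, b₂, b₃, b₄, b₅, b₆, b₇, b₈, b₉, b₁₀, b₁₁, b₁₂, b₁₃,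
        b₁₄, b₁₅, b₁₆, b₁₇, b₁₈, b₁₉, b₂₀, b₂₁]) =
      [-b₅, -b₄, -b₃, b₇, b₆, -a₂, -a₁, b₁₃, b₁₄, -b₂₀, -b₂₁, -b₁₂, -b₁₁, -b₁₀, -b₁₇, -b₁₆, -b₁₅,
        b₁₉, b₁₈, a₅, a₆] ++ l ++ [b₉, b₈, -b₂, -b₁, -a₄, -a₃] := by
  simp [applyFlips, pancakeFlip, List.take_append, List.drop_append, hl, List.take_of_length_le,
    List.drop_of_length_le]

theorem length_unwindFlips (r : ℕ) : (unwindFlips r).length = 4 * r := by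
  induction r with
  | zero => rfl
  | succ r ih => simp [unwindFlips, ih]; omega

theorem length_pullFlips (p r : ℕ) : (pullFlips p r).length = 2 * r := by
  induction r generalizing p with
  | zero => rfl
  | succ r ih => simp [pullFlips, ih]; omega

theorem le_of_mem_unwindFlips {r k : ℕ} (hk : k ∈ unwindFlips r) : 1 ≤ k ∧ k ≤ 8 * r + 4 := by
  induction r with
  | zero => simp [unwindFlips] at hk
  | succ r ih =>
    simp only [unwindFlips, List.mem_append, List.mem_cons, List.not_mem_nil, or_false] at hk
    rcases hk with (hk | hk | hk | hk) | hk
    · omega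
    · omega
    · omega
    · omega
    · have := ih hk
      omega

theorem le_of_mem_pullFlips {p r k : ℕ} (hk : k ∈ pullFlips p r) : 1 ≤ k ∧ k ≤ p + 8 * r := by
  induction r generalizing p with
  | zero => simp [pullFlips] at hk
  | succ r ih =>
    simp only [pullFlips, List.mem_append, List.mem_cons, List.not_mem_nil, or_false] at hk
    rcases hk with (hk | hk) | hk
    · omega
    · omega
    · have := ih hk
      omega

theorem pancakeFlip_eq_map_complement {n r : ℕ} {s v : ℤ} {a b c : List ℤ}
    (hlen : a.length + 8 * r + b.length + c.length + 1 = n) (hs : (n : ℤ) + 1 = 2 * s + 4)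
    (hr : 4 * (r : ℤ) < s) (ha : a.map (complement (n + 1)) = negReverse c)
    (hb : b.map (complement (n + 1)) = negReverse b)
    (hc : c.map (complement (n + 1)) = negReverse a) (hv : complement (n + 1) v = v) :
    pancakeFlip (n - 1) (a ++ negReverse (pulled s r) ++ b ++ unpulled s r ++ c ++ [v]) =
      (a ++ negReverse (pulled s r) ++ b ++ unpulled s r ++ c ++ [v]).map
        (complement (n + 1)) := by
  rw [pancakeFlip_append]
  · simp [ha, hb, hc, hv, map_negReverse (complement_neg _), map_complement_pulled hs hr,
      map_complement_unpulled hs hr]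
  · simp [length_pulled, length_unpulled]
    omega

/-- The first half of a shortest sorting sequence when `n = 8 * r + 15`. -/
def oddHalf (r : ℕ) : List ℕ :=
  [8 * r + 10] ++ unwindFlips r ++
    [4, 8 * r + 6, 8 * r + 14, 6, 4, 10, 8 * r + 15, 8 * r + 10, 4] ++ pullFlips 8 r ++ [4 * r + 6]

/-- The first half of a shortest sorting sequence when `n = 8 * r + 27`. -/
def evenHalf (r : ℕ) : List ℕ :=
  [8 * r + 22, 8 * r + 16, 8 * r + 10] ++ unwindFlips r ++
    [8 * r + 18, 8 * r + 26, 6, 4, 12, 8 * r + 14, 8 * r + 22, 6, 4, 10, 8 * r + 27,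
      8 * r + 12, 4, 8 * r + 8, 8 * r + 22, 4] ++ pullFlips 20 r ++ [4 * r + 6]

theorem burntRun_four (a : ℤ) : burntRun a 4 = [-a, -(a + 1), -(a + 2), -(a + 3)] := by
  simp [burntRun, List.range_succ]

theorem burntRun_six (a : ℤ) :
    burntRun a 6 = [-a, -(a + 1), -(a + 2), -(a + 3), -(a + 4), -(a + 5)] := by
  simp [burntRun, List.range_succ]

theorem applyFlips_pullFlips_unwound (s : ℤ) {p : ℕ} {l : List ℤ} (hl : l.length = p) (r : ℕ)
    (q : List ℤ) :
    applyFlips (pullFlips p r) (l ++ [-(s + 5)] ++ unwound s r ++ q) =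
      pulled s r ++ l ++ unpulled s r ++ [-(s + 4 * r + 5)] ++ q := by
  have := applyFlips_pullFlips s hl r ([-(s + 4 * r + 5)] ++ q)
  rw [← List.append_assoc, List.append_assoc l, ← cons_unwound] at this
  simpa using this

theorem applyFlips_oddHalf (r : ℕ) (s : ℤ) (hs : s = 4 * r + 6) :
    applyFlips (oddHalf r) (negReverse (burntStack (8 * r + 15))) =
      [-(s + 1), -4, -3, -(8 * r + 14), -(8 * r + 15), 5] ++ negReverse (pulled s r) ++
        [s, -(s + 4)] ++ unpulled s r ++
        [-(8 * (r : ℤ) + 11), 1, 2, 8 * r + 13, 8 * r + 12, s + 3] ++ [s + 2] := by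
  have h₀ : burntStack (8 * r + 15) = [-1, -2, -3, -4, -5] ++ (burntRun (s - 4 * r) (8 * r + 6) ++
      [-(8 * (r : ℤ) + 12), -(8 * r + 13), -(8 * r + 14), -(8 * r + 15)]) := by
    rw [burntStack_eq_burntRun, show 8 * r + 15 = 5 + (8 * r + 6 + 4) by ring, burntRun_add,
      burntRun_add _ (8 * r + 6) 4, show s - 4 * r = 1 + (5 : ℕ) by rw [hs]; push_cast; ring,
      show burntRun 1 5 = [-1, -2, -3, -4, -5] from rfl, burntRun_four]
    simp
    omega
  have h₂ := applyFlips_odd_turn (length_unwound s r) (-s) (-(s + 1)) (-(s + 2)) (-(s + 3))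
    (-(s + 4)) (-(s + 5)) (-(8 * (r : ℤ) + 12)) (-(8 * r + 13)) (-(8 * r + 14)) (-(8 * r + 15))
    5 4 3 2 1
  have h₃ := applyFlips_pullFlips_unwound s (p := 8)
    (l := [-5, 8 * (r : ℤ) + 15, 8 * r + 14, 3, 4, s + 1, s, -(s + 4)]) rfl r
    [1, 2, 8 * (r : ℤ) + 13, 8 * r + 12, s + 3, s + 2]
  rw [oddHalf, applyFlips_append, applyFlips_append, applyFlips_append]
  have h₄ : applyFlips ([8 * r + 10] ++ unwindFlips r) (negReverse (burntStack (8 * r + 15))) =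
      [-s, -(s + 1), -(s + 2), -(s + 3), -(s + 4), -(s + 5)] ++ unwound s r ++
        [-(8 * (r : ℤ) + 12), -(8 * r + 13), -(8 * r + 14), -(8 * r + 15), 5, 4, 3, 2, 1] := by
    rw [h₀, List.singleton_append,
      applyFlips_cons_of_eq_append (negReverse (burntRun (s - 4 * r) (8 * r + 6) ++
        [-(8 * (r : ℤ) + 12), -(8 * r + 13), -(8 * r + 14), -(8 * r + 15)])) [5, 4, 3, 2, 1]
        (by simp) (by simp), negReverse_negReverse, List.append_assoc, applyFlips_unwindFlips,
      burntRun_six]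
    rfl
  rw [h₄, h₂]
  simp only [List.append_assoc, List.cons_append, List.nil_append, neg_neg] at h₃ ⊢
  rw [h₃, applyFlips_cons_of_eq_append (pulled s r ++ [-5, 8 * (r : ℤ) + 15, 8 * r + 14, 3, 4,
    s + 1]) _ (by simp; rfl) (by simp [length_pulled]), applyFlips_nil]
  simp
  omega

theorem applyFlips_evenHalf (r : ℕ) (s : ℤ) (hs : s = 4 * r + 12) :
    applyFlips (evenHalf r) (negReverse (burntStack (8 * r + 27))) =
      [-(s + 1), -10, -9, -(8 * r + 20), -(8 * r + 21), 11] ++ negReverse (pulled s r) ++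
        [s, -(8 * r + 24), -(8 * r + 25), -2, -1, 8 * r + 23, 8 * r + 22, -6, -5, 8 * r + 27,
          8 * r + 26, 3, 4, -(s + 4)] ++ unpulled s r ++
        [-(8 * (r : ℤ) + 17), 7, 8, 8 * r + 19, 8 * r + 18, s + 3] ++ [s + 2] := by
  have h₀ : burntStack (8 * r + 27) = [-1, -2, -3, -4, -5] ++ ([-6, -7, -8, -9, -10, -11] ++
      (burntRun (s - 4 * r) (8 * r + 6) ++ [-(8 * (r : ℤ) + 18), -(8 * r + 19), -(8 * r + 20),
        -(8 * r + 21)]) ++ [-(8 * (r : ℤ) + 22), -(8 * r + 23), -(8 * r + 24), -(8 * r + 25),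
        -(8 * r + 26), -(8 * r + 27)]) := by
    rw [burntStack_eq_burntRun, show 8 * r + 27 = 5 + (6 + (8 * r + 6 + 4) + 6) by ring,
      burntRun_add, burntRun_add _ (6 + (8 * r + 6 + 4)) 6, burntRun_add _ 6,
      burntRun_add _ (8 * r + 6) 4,
      show s - 4 * r = 1 + (5 : ℕ) + (6 : ℕ) by rw [hs]; push_cast; ring,
      show burntRun 1 5 = [-1, -2, -3, -4, -5] from rfl, burntRun_four, burntRun_six, burntRun_six]
    simp
    omega
  have h₂ := applyFlips_even_turn (length_unwound s r) (-s) (-(s + 1)) (-(s + 2)) (-(s + 3))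
    (-(s + 4)) (-(s + 5)) (-(8 * (r : ℤ) + 18)) (-(8 * r + 19)) (-(8 * r + 20)) (-(8 * r + 21))
    11 10 9 8 7 6 (-(8 * r + 22)) (-(8 * r + 23)) (-(8 * r + 24)) (-(8 * r + 25)) (-(8 * r + 26))
    (-(8 * r + 27)) 5 4 3 2 1
  have h₃ := applyFlips_pullFlips_unwound s (p := 20)
    (l := [-11, 8 * (r : ℤ) + 21, 8 * r + 20, 9, 10, s + 1, s, -(8 * r + 24), -(8 * r + 25), -2, -1,
      8 * r + 23, 8 * r + 22, -6, -5, 8 * r + 27, 8 * r + 26, 3, 4, -(s + 4)]) rfl r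
    [7, 8, 8 * (r : ℤ) + 19, 8 * r + 18, s + 3, s + 2]
  rw [evenHalf, applyFlips_append, applyFlips_append, applyFlips_append]
  have h₄ : applyFlips ([8 * r + 22, 8 * r + 16, 8 * r + 10] ++ unwindFlips r)
        (negReverse (burntStack (8 * r + 27))) =
      [-s, -(s + 1), -(s + 2), -(s + 3), -(s + 4), -(s + 5)] ++ unwound s r ++
        [-(8 * (r : ℤ) + 18), -(8 * r + 19), -(8 * r + 20), -(8 * r + 21), 11, 10, 9, 8, 7, 6,
          -(8 * r + 22), -(8 * r + 23), -(8 * r + 24), -(8 * r + 25), -(8 * r + 26),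
          -(8 * r + 27), 5, 4, 3, 2, 1] := by
    rw [h₀, List.cons_append,
      applyFlips_cons_of_eq_append (negReverse ([-6, -7, -8, -9, -10, -11] ++
        (burntRun (s - 4 * r) (8 * r + 6) ++ [-(8 * (r : ℤ) + 18), -(8 * r + 19), -(8 * r + 20),
          -(8 * r + 21)]) ++ [-(8 * (r : ℤ) + 22), -(8 * r + 23), -(8 * r + 24), -(8 * r + 25),
          -(8 * r + 26), -(8 * r + 27)])) [5, 4, 3, 2, 1] (by simp) (by simp),
      negReverse_negReverse, List.cons_append,
      applyFlips_cons_of_eq_append ([-6, -7, -8, -9, -10, -11] ++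
        (burntRun (s - 4 * r) (8 * r + 6) ++ [-(8 * (r : ℤ) + 18), -(8 * r + 19), -(8 * r + 20),
          -(8 * r + 21)])) ([-(8 * (r : ℤ) + 22), -(8 * r + 23), -(8 * r + 24), -(8 * r + 25),
          -(8 * r + 26), -(8 * r + 27)] ++ [5, 4, 3, 2, 1]) (by simp) (by simp),
      List.singleton_append,
      applyFlips_cons_of_eq_append (negReverse (burntRun (s - 4 * r) (8 * r + 6) ++
        [-(8 * (r : ℤ) + 18), -(8 * r + 19), -(8 * r + 20), -(8 * r + 21)]))
        _ (by rw [negReverse_append _ (_ ++ _), List.append_assoc]) (by simp),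
      negReverse_negReverse, List.append_assoc, applyFlips_unwindFlips, burntRun_six]
    simp
  rw [h₄, h₂]
  simp only [List.append_assoc, List.cons_append, List.nil_append, neg_neg] at h₃ ⊢
  rw [h₃, applyFlips_cons_of_eq_append (pulled s r ++ [-11, 8 * (r : ℤ) + 21, 8 * r + 20, 9, 10,
    s + 1]) _ (by simp; rfl) (by simp [length_pulled]), applyFlips_nil]
  simp
  omega

theorem isSortingSeq_oddHalf (r : ℕ) :
    IsSortingSeq (8 * r + 15)
      ((8 * r + 15) :: oddHalf r ++ (8 * r + 15 - 1) :: (oddHalf r).reverse) := by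
  refine isSortingSeq_of_symmetric (by omega) (fun k hk => ?_) ?_
  · simp only [oddHalf, List.mem_append, List.mem_cons, List.not_mem_nil, or_false] at hk
    rcases hk with (((hk | hk) | hk) | hk) | hk
    · omega
    · have := le_of_mem_unwindFlips hk
      omega
    · omega
    · have := le_of_mem_pullFlips hk
      omega
    · omega
  · rw [applyFlips_oddHalf r _ rfl]
    refine pancakeFlip_eq_map_complement ?_ ?_ ?_ ?_ ?_ ?_ ?_
    · simp
      omega
    · push_cast
      ring
    · omega
    all_goals
      simp [complement]
      repeat' apply And.intro
      all_goals
        omega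

theorem isSortingSeq_evenHalf (r : ℕ) :
    IsSortingSeq (8 * r + 27)
      ((8 * r + 27) :: evenHalf r ++ (8 * r + 27 - 1) :: (evenHalf r).reverse) := by
  refine isSortingSeq_of_symmetric (by omega) (fun k hk => ?_) ?_
  · simp only [evenHalf, List.mem_append, List.mem_cons, List.not_mem_nil, or_false] at hk
    rcases hk with (((hk | hk) | hk) | hk) | hk
    · omega
    · have := le_of_mem_unwindFlips hk
      omega
    · omega
    · have := le_of_mem_pullFlips hk
      omega
    · omega
  · rw [applyFlips_evenHalf r _ rfl]
    refine pancakeFlip_eq_map_complement ?_ ?_ ?_ ?_ ?_ ?_ ?_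
    · simp
      omega
    · push_cast
      ring
    · omega
    all_goals
      simp [complement]
      repeat' apply And.intro
      all_goals
        omega

theorem exists_isSortingSeq {n : ℕ} (hn : 23 ≤ n) (hmod : n % 4 = 3) :
    ∃ ks, IsSortingSeq n ks ∧ ks.length = (3 * n + 3) / 2 := by
  obtain h | h : n % 8 = 7 ∨ n % 8 = 3 := by omega
  · obtain ⟨r, rfl⟩ : ∃ r, n = 8 * r + 15 := ⟨(n - 15) / 8, by omega⟩
    refine ⟨_, isSortingSeq_oddHalf r, ?_⟩
    simp [oddHalf, length_unwindFlips, length_pullFlips]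
    omega
  · obtain ⟨r, rfl⟩ : ∃ r, n = 8 * r + 27 := ⟨(n - 27) / 8, by omega⟩
    refine ⟨_, isSortingSeq_evenHalf r, ?_⟩
    simp [evenHalf, length_unwindFlips, length_pullFlips]
    omega

/-- `1` if `y` is the successor of `x`, `-1` if it is the predecessor, and `0` otherwise. -/
def adjacency (x y : ℤ) : ℤ := if y = x + 1 then 1 else if y = x - 1 then -1 else 0

/-- The common value of two adjacencies that agree, and `0` otherwise. -/
def agreement (a b : ℤ) : ℤ := if a = b then a else 0

/-- A correction to the weight of a descending adjacency between the labels `1` and `2`. -/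
def defect (x y : ℤ) : ℤ := if (x = 2 ∧ y = 1) ∨ (x = -1 ∧ y = -2) then 1 else 0

/-- The contribution to the potential of the two topmost pancakes `x` and `y` of a stack. -/
def topWeight (x y : ℤ) : ℤ := adjacency x y - if x = 1 ∧ y ≠ 2 then 1 else 0

/-- The contribution to the potential of `w', w` as the lower end of a block lying on `y, y'`, less
that of the same pair, turned upside down, as the top of the stack. -/
def score (w' w y y' : ℤ) : ℤ :=
  2 * adjacency w y - defect w y + agreement (adjacency w y) (adjacency y y') +
    agreement (adjacency w' w) (adjacency w y) - topWeight (-w) (-w')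

theorem adjacency_cases (x y : ℤ) : (y = x + 1 ∧ adjacency x y = 1) ∨
    (y = x - 1 ∧ adjacency x y = -1) ∨ (y ≠ x + 1 ∧ y ≠ x - 1 ∧ adjacency x y = 0) := by
  unfold adjacency
  omega

theorem adjacency_neg_neg (x y : ℤ) : adjacency (-x) (-y) = adjacency y x := by
  unfold adjacency
  omega

theorem score_le {w' w y y' : ℤ} (hw' : w' ≠ 0) (hy : y ≠ 0) (h : w' ≠ y) :
    score w' w y y' ≤ 3 ∧ (¬ (y = w + 1 ∧ y' = y + 1) → score w' w y y' ≤ 2) ∧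
      (y ≠ w + 1 → score w' w y y' ≤ 1) := by
  unfold score topWeight
  rcases adjacency_cases w y with ⟨_, e₁⟩ | ⟨_, e₁⟩ | ⟨_, _, e₁⟩ <;>
  rcases adjacency_cases y y' with ⟨_, e₂⟩ | ⟨_, e₂⟩ | ⟨_, _, e₂⟩ <;>
  rcases adjacency_cases w' w with ⟨_, e₃⟩ | ⟨_, e₃⟩ | ⟨_, _, e₃⟩ <;>
  rw [adjacency_neg_neg, e₁, e₂, e₃] <;>
  simp only [agreement, defect] <;> omega

theorem le_score {w' w y y' : ℤ} (hy' : y' ≠ 0) (h : w' ≠ y) :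
    -3 ≤ score w' w y y' ∧
      (¬ (y = w - 1 ∧ (y' = y - 1 ∨ w = 2)) → -2 ≤ score w' w y y') ∧
      (y ≠ w - 1 → -1 ≤ score w' w y y') := by
  unfold score topWeight
  rcases adjacency_cases w y with ⟨_, e₁⟩ | ⟨_, e₁⟩ | ⟨_, _, e₁⟩ <;>
  rcases adjacency_cases y y' with ⟨_, e₂⟩ | ⟨_, e₂⟩ | ⟨_, _, e₂⟩ <;>
  rcases adjacency_cases w' w with ⟨_, e₃⟩ | ⟨_, e₃⟩ | ⟨_, _, e₃⟩ <;>
  rw [adjacency_neg_neg, e₁, e₂, e₃] <;>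
  simp only [agreement, defect] <;> omega

theorem score_sub_score_le {v' v w' w y y' : ℤ} (hv' : v' ≠ 0) (hv : v ≠ 0) (hy : y ≠ 0)
    (hy' : y' ≠ 0) (hvy : v' ≠ y) (hwy : w' ≠ y) (h₁ : v ≠ y') (h₂ : w ≠ y') :
    score v' v y y' - score w' w y y' ≤ 4 := by
  have := score_le (w := v) (y' := y') hv' hy hvy
  have := le_score (w := w) hy' hwy
  omega

theorem singleton_flip_le {x y y' : ℤ} (hy : y ≠ 0) (hy' : y' ≠ 0) :
    2 * adjacency (-x) y - defect (-x) y + agreement (adjacency (-x) y) (adjacency y y') +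
        topWeight (-x) y -
      (2 * adjacency x y - defect x y + agreement (adjacency x y) (adjacency y y') +
        topWeight x y) ≤ 4 := by
  unfold topWeight
  rcases adjacency_cases x y with ⟨_, e₁⟩ | ⟨_, e₁⟩ | ⟨_, _, e₁⟩ <;>
  rcases adjacency_cases y y' with ⟨_, e₂⟩ | ⟨_, e₂⟩ | ⟨_, _, e₂⟩ <;>
  rcases adjacency_cases (-x) y with ⟨_, e₃⟩ | ⟨_, e₃⟩ | ⟨_, _, e₃⟩ <;>
  rw [e₁, e₂, e₃] <;>
  simp only [agreement, defect] <;> omega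

/-- The adjacency of the bottom pancake of a stack of size `n` with the plate. -/
def plateAdjacency (n : ℕ) (x : ℤ) : ℤ := if x = n then 1 else if x = -n then -1 else 0

/-- The adjacency of a pancake `x` with what lies below it. -/
def lowerAdjacency (n : ℕ) (x : ℤ) : List ℤ → ℤ
  | [] => plateAdjacency n x
  | y :: _ => adjacency x y

/-- The contribution of a pancake `x` lying on top of a list to `chainWeight`. -/
def linkWeight (n : ℕ) (x : ℤ) : List ℤ → ℤ
  | [] => 3 * plateAdjacency n x
  | y :: l => 2 * adjacency x y - defect x y + agreement (adjacency x y) (lowerAdjacency n y l)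

/-- The total weight of the adjacencies in a stack, including the one with the plate. -/
def chainWeight (n : ℕ) : List ℤ → ℤ
  | [] => 0
  | x :: l => linkWeight n x l + chainWeight n l

/-- The contribution of the two topmost pancakes of a stack to the potential. -/
def headWeight : List ℤ → ℤ
  | x :: y :: _ => topWeight x y
  | _ => 0

/-- A potential that increases by at most `4` with each flip. -/
def potential (n : ℕ) (l : List ℤ) : ℤ := chainWeight n l + headWeight l

/-- The weight of the adjacencies within a block. -/
def innerWeight : List ℤ → ℤ
  | x :: y :: z :: l => 2 * adjacency x y - defect x y +
      agreement (adjacency x y) (adjacency y z) + innerWeight (y :: z :: l)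
  | [x, y] => 2 * adjacency x y - defect x y
  | _ => 0

theorem defect_neg_neg (x y : ℤ) : defect (-x) (-y) = defect y x := by
  unfold defect
  omega

theorem agreement_comm (a b : ℤ) : agreement a b = agreement b a := by
  unfold agreement
  omega

theorem innerWeight_append (l : List ℤ) (x y z : ℤ) :
    innerWeight (l ++ [x, y, z]) = innerWeight (l ++ [x, y]) +
      (2 * adjacency y z - defect y z) + agreement (adjacency x y) (adjacency y z) := by
  induction l with
  | nil => simp [innerWeight]; ring
  | cons a l ih =>
    match l with
    | [] => simp [innerWeight]; ring
    | [b] => simp [innerWeight]; ring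
    | b :: c :: l =>
      simp only [List.cons_append, innerWeight] at ih ⊢
      rw [ih]
      ring

theorem innerWeight_negReverse : ∀ l : List ℤ, innerWeight (negReverse l) = innerWeight l
  | [] => rfl
  | [_] => rfl
  | [x, y] => by simp [innerWeight, adjacency_neg_neg, defect_neg_neg]
  | x :: y :: z :: l => by
    have ih := innerWeight_negReverse (y :: z :: l)
    simp only [negReverse_cons, List.append_assoc, List.cons_append, List.nil_append] at ih ⊢
    rw [innerWeight_append, ih, innerWeight, adjacency_neg_neg, adjacency_neg_neg, defect_neg_neg,
      agreement_comm]
    ring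

theorem chainWeight_append (n : ℕ) (l : List ℤ) (x y : ℤ) (q : List ℤ) :
    chainWeight n (l ++ x :: y :: q) = innerWeight (l ++ [x, y]) +
      agreement (adjacency x y) (lowerAdjacency n y q) + linkWeight n y q + chainWeight n q := by
  induction l with
  | nil => simp [innerWeight, chainWeight, linkWeight]; ring
  | cons a l ih =>
    rw [List.cons_append, chainWeight, ih]
    match l with
    | [] => simp [innerWeight, linkWeight, lowerAdjacency]; ring
    | [b] => simp [innerWeight, linkWeight, lowerAdjacency]; ring
    | b :: c :: l =>
      simp only [List.cons_append, innerWeight, linkWeight, lowerAdjacency]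
      ring

theorem exists_adjacency_eq {n : ℕ} {y : ℤ} (hy : y ≠ 0 ∧ |y| ≤ n) (l : List ℤ) :
    ∃ y', (y' ∈ l ∨ (n : ℤ) < |y'|) ∧ lowerAdjacency n y l = adjacency y y' := by
  match l with
  | z :: l => exact ⟨z, by simp, rfl⟩
  | [] =>
    obtain ⟨hy₀, hy⟩ := hy
    rw [abs_le] at hy
    by_cases h : y = -n
    · refine ⟨-(n + 1), Or.inr ?_, ?_⟩
      · rw [abs_neg, abs_of_nonneg] <;> omega
      · change plateAdjacency n y = _
        unfold plateAdjacency adjacency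
        omega
    · refine ⟨n + 1, Or.inr ?_, ?_⟩
      · rw [abs_of_nonneg] <;> omega
      · change plateAdjacency n y = _
        unfold plateAdjacency adjacency
        omega

theorem exists_adjacency_eq_adjacency {n : ℕ} (hn : 2 ≤ n) {v w : ℤ} (hv : |v| ≤ n) (hw : |w| ≤ n)
    (hvw : v ≠ -w) {l : List ℤ} (hl : ∀ y ∈ l, y ≠ 0 ∧ |y| ≤ n) :
    ∃ y y', (y ∈ l ∨ (n : ℤ) < |y|) ∧ (y' ∈ l ∨ (n : ℤ) < |y'|) ∧
      ∀ u, u = v ∨ u = w → lowerAdjacency n u l = adjacency u y ∧ linkWeight n u l =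
        2 * adjacency u y - defect u y + agreement (adjacency u y) (adjacency y y') := by
  match l with
  | y :: l =>
    obtain ⟨y', h, h'⟩ := exists_adjacency_eq (hl y (by simp)) l
    refine ⟨y, y', by simp, by simp; tauto, fun u _ => ⟨rfl, ?_⟩⟩
    rw [linkWeight, h']
  | [] =>
    rw [abs_le] at hv hw
    by_cases h : v = -n ∨ w = -n
    · refine ⟨-(n + 1), -(n + 2), Or.inr ?_, Or.inr ?_, fun u hu => ?_⟩
      · rw [abs_neg, abs_of_nonneg] <;> omega
      · rw [abs_neg, abs_of_nonneg] <;> omega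
      · have h₁ : plateAdjacency n u = adjacency u (-(n + 1)) := by
          unfold plateAdjacency adjacency
          rcases hu with rfl | rfl <;> omega
        have h₂ : adjacency (-(n + 1)) (-(n + 2)) = -1 := by
          unfold adjacency
          omega
        refine ⟨h₁, ?_⟩
        rw [linkWeight, h₁, h₂]
        unfold adjacency defect agreement
        rcases hu with rfl | rfl <;> omega
    · refine ⟨n + 1, n + 2, Or.inr ?_, Or.inr ?_, fun u hu => ?_⟩
      · rw [abs_of_nonneg] <;> omega
      · rw [abs_of_nonneg] <;> omega
      · have h₁ : plateAdjacency n u = adjacency u (n + 1) := by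
          unfold plateAdjacency adjacency
          rcases hu with rfl | rfl <;> omega
        have h₂ : adjacency (n + 1) (n + 2) = 1 := by
          unfold adjacency
          omega
        refine ⟨h₁, ?_⟩
        rw [linkWeight, h₁, h₂]
        unfold adjacency defect agreement
        rcases hu with rfl | rfl <;> omega

/-- The labels of `l`, without their signs, are `1, …, n`. -/
def IsStack (n : ℕ) (l : List ℤ) : Prop :=
  (l.map Int.natAbs).Perm ((List.range n).map (· + 1))

theorem IsStack.length_eq {n : ℕ} {l : List ℤ} (h : IsStack n l) : l.length = n := by
  simpa using List.Perm.length_eq h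

theorem IsStack.nodup {n : ℕ} {l : List ℤ} (h : IsStack n l) : (l.map Int.natAbs).Nodup :=
  h.nodup_iff.2 (List.nodup_range.map (add_left_injective 1))

theorem IsStack.abs_bounds {n : ℕ} {l : List ℤ} (h : IsStack n l) {v : ℤ} (hv : v ∈ l) :
    v ≠ 0 ∧ |v| ≤ n := by
  have := h.subset (List.mem_map_of_mem (f := Int.natAbs) hv)
  simp only [List.mem_map, List.mem_range] at this
  obtain ⟨i, hi, hiv⟩ := this
  rw [Int.abs_eq_natAbs]
  omega

theorem IsStack.pancakeFlip {n : ℕ} {l : List ℤ} (h : IsStack n l) (k : ℕ) :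
    IsStack n (pancakeFlip k l) := by
  refine List.Perm.trans ?_ h
  conv_rhs => rw [← List.take_append_drop k l]
  rw [_root_.pancakeFlip, List.map_append, List.map_append]
  refine List.Perm.append_right _ ?_
  rw [List.map_reverse, List.map_map]
  refine (List.reverse_perm _).trans ?_
  simp [Function.comp_def]

theorem isStack_burntStack (n : ℕ) : IsStack n (burntStack n) := by
  rw [IsStack, burntStack_eq_map, List.map_map]
  refine List.Perm.of_eq (List.map_congr_left fun i _ => ?_)
  simp only [Function.comp_apply]
  omega

theorem IsStack.natAbs_ne {n : ℕ} {p q : List ℤ} (h : IsStack n (p ++ q)) {x y : ℤ} (hx : x ∈ p)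
    (hy : y ∈ q) : x.natAbs ≠ y.natAbs := by
  have := h.nodup
  rw [List.map_append, List.nodup_append] at this
  exact this.2.2 _ (List.mem_map_of_mem hx) _ (List.mem_map_of_mem hy)

theorem IsStack.natAbs_ne_of_mem_or_lt {n : ℕ} {p q : List ℤ} (h : IsStack n (p ++ q)) {x y : ℤ}
    (hx : x ∈ p) (hy : y ∈ q ∨ (n : ℤ) < |y|) : x.natAbs ≠ y.natAbs ∧ y ≠ 0 := by
  have := h.abs_bounds (List.mem_append_left q hx)
  rw [Int.abs_eq_natAbs] at this hy
  obtain hy | hy := hy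
  · exact ⟨h.natAbs_ne hx hy, (h.abs_bounds (List.mem_append_right p hy)).1⟩
  · omega

theorem ne_of_natAbs_ne {x y : ℤ} (h : x.natAbs ≠ y.natAbs) : x ≠ y ∧ -x ≠ y := by omega

theorem exists_eq_append_pair (a b : ℤ) (l : List ℤ) : ∃ m c d, a :: b :: l = m ++ [c, d] := by
  induction l generalizing a b with
  | nil => exact ⟨[], a, b, rfl⟩
  | cons e l ih =>
    obtain ⟨m, c, d, h⟩ := ih b e
    exact ⟨a :: m, c, d, by rw [h]; rfl⟩

theorem potential_pancakeFlip_le {n k : ℕ} (hn : 2 ≤ n) {l : List ℤ} (h : IsStack n l) (hk : 1 ≤ k)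
    (hk' : k ≤ n) : potential n (pancakeFlip k l) ≤ potential n l + 4 := by
  have hl := h.length_eq
  obtain ⟨p, q, rfl, hp⟩ : ∃ p q, l = p ++ q ∧ p.length = k :=
    ⟨l.take k, l.drop k, (List.take_append_drop k l).symm, by simp; omega⟩
  rw [pancakeFlip_append k p q hp]
  match p, q with
  | [], _ => simp at hp; omega
  | [x], [] => simp at hl; omega
  | [x], y :: q =>
    obtain ⟨y', hy', hadj⟩ := exists_adjacency_eq (h.abs_bounds (v := y) (by simp)) q
    have h₂ := h.natAbs_ne_of_mem_or_lt (x := x) (y := y') (by simp) (by simp; tauto)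
    have h₃ := (h.abs_bounds (v := y) (by simp)).1
    have := singleton_flip_le (x := x) h₃ h₂.2
    simp [potential, chainWeight, linkWeight, headWeight, hadj]
    omega
  | x₁ :: x₂ :: r, q =>
    obtain ⟨s, z₂, z₁, hs⟩ := exists_eq_append_pair x₁ x₂ r
    have hx₁ : x₁ ∈ x₁ :: x₂ :: r := by simp
    have hx₂ : x₂ ∈ x₁ :: x₂ :: r := by simp
    have hz₁ : z₁ ∈ x₁ :: x₂ :: r := by simp [hs]
    have hz₂ : z₂ ∈ x₁ :: x₂ :: r := by simp [hs]
    have hx₁' := h.abs_bounds (List.mem_append_left q hx₁)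
    have hx₂' := h.abs_bounds (List.mem_append_left q hx₂)
    have hz₁' := h.abs_bounds (List.mem_append_left q hz₁)
    have hxz : x₁.natAbs ≠ z₁.natAbs := by
      have hnd := h.nodup
      rw [List.map_append, List.nodup_append, hs] at hnd
      replace hnd := hnd.1
      match s with
      | [] =>
        obtain ⟨rfl, -⟩ : x₁ = z₂ ∧ x₂ = z₁ ∧ r = [] := by simpa using hs
        simpa using hnd
      | a :: s =>
        obtain ⟨rfl, -⟩ : x₁ = a ∧ x₂ :: r = s ++ [z₂, z₁] := by simpa using hs
        simp at hnd
        tauto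
    obtain ⟨y, y', hy, hy', hadj⟩ := exists_adjacency_eq_adjacency hn (v := -x₁) (w := z₁) (l := q)
      (by rw [abs_neg]; exact hx₁'.2) hz₁'.2 (by omega)
      (fun y hy => h.abs_bounds (List.mem_append_right _ hy))
    have h₁ := h.natAbs_ne_of_mem_or_lt hx₁ hy'
    have h₂ := h.natAbs_ne_of_mem_or_lt hx₂ hy
    have h₃ := h.natAbs_ne_of_mem_or_lt hz₁ hy'
    have h₄ := h.natAbs_ne_of_mem_or_lt hz₂ hy
    have hscore := score_sub_score_le (neg_ne_zero.2 hx₂'.1) (neg_ne_zero.2 hx₁'.1) h₂.2 h₁.2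
      (ne_of_natAbs_ne h₂.1).2 (ne_of_natAbs_ne h₄.1).1
      (ne_of_natAbs_ne h₁.1).2 (ne_of_natAbs_ne h₃.1).1
    have hold : potential n (x₁ :: x₂ :: r ++ q) = innerWeight (s ++ [z₂, z₁]) +
        agreement (adjacency z₂ z₁) (lowerAdjacency n z₁ q) + linkWeight n z₁ q +
        chainWeight n q + topWeight x₁ x₂ := by
      have := chainWeight_append n s z₂ z₁ q
      rw [← this, show s ++ z₂ :: z₁ :: q = x₁ :: x₂ :: r ++ q by simp [hs]]
      rfl
    have hnew : potential n (negReverse (x₁ :: x₂ :: r) ++ q) = innerWeight (s ++ [z₂, z₁]) +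
        agreement (adjacency (-x₂) (-x₁)) (lowerAdjacency n (-x₁) q) + linkWeight n (-x₁) q +
        chainWeight n q + topWeight (-z₁) (-z₂) := by
      have := chainWeight_append n (negReverse r) (-x₂) (-x₁) q
      rw [show negReverse r ++ [-x₂, -x₁] = negReverse (x₁ :: x₂ :: r) by simp,
        innerWeight_negReverse, hs] at this
      rw [← this, show negReverse r ++ -x₂ :: -x₁ :: q = negReverse (x₁ :: x₂ :: r) ++ q by simp,
        potential, hs]
      simp [headWeight]
    rw [hold, hnew, (hadj _ (Or.inl rfl)).1, (hadj _ (Or.inl rfl)).2, (hadj _ (Or.inr rfl)).1,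
      (hadj _ (Or.inr rfl)).2]
    simp only [score, neg_neg] at hscore
    omega

theorem potential_applyFlips_le {n : ℕ} (hn : 2 ≤ n) {ks : List ℕ} (hks : ∀ k ∈ ks, 1 ≤ k ∧ k ≤ n)
    {l : List ℤ} (h : IsStack n l) :
    potential n (applyFlips ks l) ≤ potential n l + 4 * ks.length := by
  induction ks generalizing l with
  | nil => simp [applyFlips_nil]
  | cons k ks ih =>
    rw [List.forall_mem_cons] at hks
    have h₁ := ih hks.2 (h.pancakeFlip k)
    have h₂ := potential_pancakeFlip_le hn h hks.1.1 hks.1.2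
    rw [applyFlips_cons, List.length_cons]
    push_cast
    linarith

theorem burntRun_succ (a : ℤ) (m : ℕ) : burntRun a (m + 1) = -a :: burntRun (a + 1) m := by
  rw [add_comm, burntRun_add]
  simp [burntRun]

theorem chainWeight_burntRun {n : ℕ} {a : ℤ} {m : ℕ} (ha : 1 ≤ a) (h : a + m = n) :
    lowerAdjacency n (-a) (burntRun (a + 1) m) = -1 ∧
      chainWeight n (burntRun a (m + 1)) ≤ -3 * (m + 1) := by
  induction m generalizing a with
  | zero =>
    simp [burntRun, lowerAdjacency, chainWeight, linkWeight, plateAdjacency]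
    push_cast at h
    omega
  | succ m ih =>
    push_cast at h
    obtain ⟨h₁, h₂⟩ := ih (a := a + 1) (by omega) (by omega)
    rw [burntRun_succ a, chainWeight]
    simp only [burntRun_succ (a + 1), linkWeight] at h₂ ⊢
    rw [h₁]
    have h₃ : adjacency (-a) (-(a + 1)) = -1 := by
      unfold adjacency
      omega
    have h₄ : 0 ≤ defect (-a) (-(a + 1)) := by
      unfold defect
      omega
    refine ⟨h₃, ?_⟩
    rw [h₃, agreement, if_pos rfl]
    push_cast
    linarith

theorem potential_burntStack_le {n : ℕ} (hn : 2 ≤ n) :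
    potential n (burntStack n) ≤ -(3 * n + 2) := by
  obtain ⟨m, rfl⟩ : ∃ m, n = m + 2 := ⟨n - 2, by omega⟩
  have h := chainWeight_burntRun (n := m + 2) (a := 2) (m := m) (by norm_num) (by push_cast; ring)
  rw [burntStack_eq_burntRun, burntRun_succ, potential, chainWeight]
  norm_num [burntRun_succ, linkWeight, headWeight, topWeight, adjacency, defect] at h ⊢
  rw [h.1]
  norm_num [agreement]
  linarith

/-- The increasing run `a, a + 1, …` of `m` labels. -/
def sortedRun (a : ℤ) (m : ℕ) : List ℤ := (List.range m).map fun i : ℕ => a + (i : ℤ)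

theorem sortedRun_succ (a : ℤ) (m : ℕ) : sortedRun a (m + 1) = a :: sortedRun (a + 1) m := by
  simp [sortedRun, List.range_succ_eq_map, Function.comp_def]
  intro i _
  ring

theorem chainWeight_sortedRun {n : ℕ} {a : ℤ} {m : ℕ} (ha : 1 ≤ a) (h : a + m = n) :
    lowerAdjacency n a (sortedRun (a + 1) m) = 1 ∧
      chainWeight n (sortedRun a (m + 1)) = 3 * (m + 1) := by
  induction m generalizing a with
  | zero =>
    simp [sortedRun, lowerAdjacency, chainWeight, linkWeight, plateAdjacency]
    push_cast at h
    omega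
  | succ m ih =>
    push_cast at h
    obtain ⟨h₁, h₂⟩ := ih (a := a + 1) (by omega) (by omega)
    rw [sortedRun_succ a, chainWeight]
    simp only [sortedRun_succ (a + 1), linkWeight] at h₂ ⊢
    rw [h₁]
    have h₃ : adjacency a (a + 1) = 1 := by
      unfold adjacency
      omega
    have h₄ : defect a (a + 1) = 0 := by
      unfold defect
      omega
    refine ⟨h₃, ?_⟩
    rw [h₃, h₄, agreement, if_pos rfl]
    push_cast
    linarith

theorem potential_sortedStack {n : ℕ} (hn : 2 ≤ n) : potential n (sortedStack n) = 3 * n + 1 := by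
  obtain ⟨m, rfl⟩ : ∃ m, n = m + 2 := ⟨n - 2, by omega⟩
  have h := (chainWeight_sortedRun (n := m + 2) (a := 1) (m := m + 1) le_rfl
    (by push_cast; ring)).2
  have hs : sortedStack (m + 2) = sortedRun 1 (m + 2) := by
    simp [sortedStack_eq_map, sortedRun, add_comm]
  rw [hs, potential, h]
  simp [sortedRun_succ, headWeight, topWeight, adjacency]
  ring

theorem IsSortingSeq.le_length {n : ℕ} (hn : 2 ≤ n) {ks : List ℕ} (h : IsSortingSeq n ks) :
    6 * n + 3 ≤ 4 * ks.length := by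
  have h₁ := potential_applyFlips_le hn h.1 (isStack_burntStack n)
  have h₂ := potential_burntStack_le hn
  rw [h.2, potential_sortedStack hn] at h₁
  omega

/-- (Heydari–Sudborough / Cibulka) For every integer `n ≥ 23` with `n ≡ 3 (mod 4)`,
`T n = (3n+3)/2`. -/
theorem heydari_sudborough_cibulka (n : ℕ) (hn : 23 ≤ n) (hmod : n % 4 = 3) :
    T n = (3 * n + 3) / 2 := by
  obtain ⟨ks, hks, hlen⟩ := exists_isSortingSeq hn hmod
  refine le_antisymm (Nat.sInf_le ⟨ks, hks, hlen⟩) (le_csInf ⟨_, ks, hks, hlen⟩ ?_)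
  rintro m ⟨ks', hks', rfl⟩
  have := hks'.le_length (by omega)
  omega
end

section
/- (Main Theorem) For every integer n ≥ 29 with n ≡ 1 (mod 4), the minimum number of flips needed to sort the burnt stack Ī_n = [-1, -2, ..., -n] into I_n = [1, 2, ..., n] equals (3n+3)/2, i.e., T(n) = (3n+3)/2. -/
namespace BurntPancake

section

variable {N : ℤ}

/-- The reversed and negated list. -/
def negRev (u : List ℤ) : List ℤ := (u.map Neg.neg).reverse

/-- The type of the adjacency `x, y`: `1` if ascending, `-1` if descending (or wrapping around at `N`),
`0` otherwise. -/
def mark (N x y : ℤ) : ℤ :=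
  if y = x + 1 then 1 else if x = y + 1 ∨ (y = N ∧ x = 1 - N) then -1 else 0

/-- The common value of `a` and `b`, or `0` if they differ. -/
def agree (a b : ℤ) : ℤ := if a = b then a else 0

/-- The mark of the first adjacency of a list. -/
def firstMark (N : ℤ) : List ℤ → ℤ
  | x :: y :: _ => mark N x y
  | _ => 0

/-- The mark of the last adjacency of a list. -/
def lastMark (N : ℤ) : List ℤ → ℤ
  | [] => 0
  | [_] => 0
  | [x, y] => mark N x y
  | _ :: y :: z :: l => lastMark N (y :: z :: l)

/-- Twice the sum of the marks, plus a correction for each pair of equal consecutive marks. -/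
def chain (N : ℤ) : List ℤ → ℤ
  | [] => 0
  | [_] => 0
  | x :: y :: l => 2 * mark N x y + agree (mark N x y) (firstMark N (y :: l)) + chain N (y :: l)

/-- The potential function that bounds the number of flips from below. -/
def potential (N : ℤ) (e : List ℤ) : ℤ := chain N e + firstMark N e + lastMark N e

lemma agree_zero_left (b : ℤ) : agree 0 b = 0 := by unfold agree; split <;> simp
lemma agree_zero_right (b : ℤ) : agree b 0 = 0 := by unfold agree; split <;> simp_all
lemma agree_comm (a b : ℤ) : agree a b = agree b a := by unfold agree; split <;> split <;> simp_all

lemma lastMark_concat (u : List ℤ) (a b : ℤ) : lastMark N (u ++ [a, b]) = mark N a b := by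
  induction u with
  | nil => rfl
  | cons x u ih =>
    rcases u with _ | ⟨y, _ | ⟨z, u⟩⟩
    · rfl
    · rfl
    · simpa [lastMark] using ih

lemma lastMark_append (u : List ℤ) (a b : ℤ) (v : List ℤ) :
    lastMark N (u ++ a :: b :: v) = lastMark N (a :: b :: v) := by
  induction u with
  | nil => rfl
  | cons x u ih =>
    rcases u with _ | ⟨y, _ | ⟨z, u⟩⟩
    · rfl
    · rfl
    · simpa [lastMark] using ih


/-- Splitting the chain sum at a junction. -/
lemma chain_append (u : List ℤ) (a z : ℤ) (v : List ℤ) :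
    chain N (u ++ a :: z :: v) = chain N (u ++ [a]) + chain N (z :: v) + 2 * mark N a z
      + agree (lastMark N (u ++ [a])) (mark N a z) + agree (mark N a z) (firstMark N (z :: v)) := by
  induction u with
  | nil => simp [chain, lastMark, agree_zero_left, firstMark]; ring
  | cons x u ih =>
    rcases u with _ | ⟨y, u⟩
    · simp only [List.nil_append, List.cons_append, chain, lastMark, firstMark, agree_zero_right] at *
      ring_nf at *
      try linarith
    · have h1 : lastMark N (x :: y :: u ++ [a]) = lastMark N (y :: u ++ [a]) := by
        cases u <;> rfl
      have h2 : firstMark N (y :: u ++ a :: z :: v) = firstMark N (y :: u ++ [a]) := by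
        cases u <;> rfl
      simp only [List.cons_append, chain] at *
      rw [h1, h2]
      linarith

lemma mark_neg {x y : ℤ} (hx : -x ≠ N) (hy : y ≠ N) :
    mark N (-y) (-x) = mark N x y := by
  unfold mark
  grind

lemma lastMark_negRev (u : List ℤ) (h : ∀ x ∈ u, x ≠ N ∧ -x ≠ N) :
    lastMark N (negRev u) = firstMark N u := by
  rcases u with _ | ⟨x, _ | ⟨y, u⟩⟩
  · rfl
  · rfl
  · simp only [negRev, List.map_cons, List.reverse_cons, List.append_assoc, List.cons_append,
      List.nil_append, lastMark_concat, firstMark]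
    exact mark_neg (h x (by simp)).2 (h y (by simp)).1

lemma negRev_negRev (u : List ℤ) : negRev (negRev u) = u := by
  simp [negRev, List.map_reverse]

lemma firstMark_negRev (u : List ℤ) (h : ∀ x ∈ u, x ≠ N ∧ -x ≠ N) :
    firstMark N (negRev u) = lastMark N u := by
  rw [← lastMark_negRev, negRev_negRev]
  intro x hx
  simp only [negRev, List.mem_reverse, List.mem_map] at hx
  obtain ⟨y, hy, rfl⟩ := hx
  have := h y hy
  simpa using this.symm

lemma chain_negRev (u : List ℤ) (h : ∀ x ∈ u, x ≠ N ∧ -x ≠ N) :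
    chain N (negRev u) = chain N u := by
  induction u with
  | nil => rfl
  | cons x u ih =>
    rcases u with _ | ⟨y, u⟩
    · rfl
    · have h' : ∀ x ∈ y :: u, x ≠ N ∧ -x ≠ N := fun x hx => h x (List.mem_cons_of_mem _ hx)
      have e1 : negRev (x :: y :: u) = negRev u ++ -y :: -x :: [] := by simp [negRev]
      have e2 : negRev (y :: u) = negRev u ++ [-y] := by simp [negRev]
      rw [e1, chain_append, ← e2, ih h', lastMark_negRev _ h',
        mark_neg (h x (by simp)).2 (h y (by simp)).1]
      simp only [chain, firstMark, agree_zero_right]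
      rw [agree_comm]
      ring

/-- The two integers have distinct absolute values. -/
def Apart (x y : ℤ) : Prop := x ≠ y ∧ x ≠ -y

lemma Apart.symm {x y : ℤ} (h : Apart x y) : Apart y x := ⟨h.1.symm, fun e => h.2 (by omega)⟩

lemma Apart.neg_left {x y : ℤ} (h : Apart x y) : Apart (-x) y :=
  ⟨fun e => h.2 (by omega), fun e => h.1 (by omega)⟩

lemma Apart.neg_right {x y : ℤ} (h : Apart x y) : Apart x (-y) := h.symm.neg_left.symm

lemma apart_of_bounds {x N : ℤ} (h : x ≠ 0 ∧ -N < x ∧ x < N) : Apart x N :=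
  ⟨by omega, by omega⟩

/-- Pairwise distinct absolute values, strictly between `0` and `N`. -/
def Admissible (N : ℤ) (s : List ℤ) : Prop :=
  s.Pairwise Apart ∧ ∀ x ∈ s, x ≠ 0 ∧ -N < x ∧ x < N

lemma Admissible.negRev_append {u w : List ℤ} (h : Admissible N (u ++ w)) :
    Admissible N (negRev u ++ w) := by
  obtain ⟨h1, h2⟩ := h
  rw [List.pairwise_append] at h1
  refine ⟨List.pairwise_append.2 ⟨?_, h1.2.1, ?_⟩, ?_⟩
  · rw [negRev, List.pairwise_reverse, List.pairwise_map]
    refine h1.1.imp ?_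
    exact fun hab => hab.symm.neg_left.neg_right
  · intro a ha b hb
    simp only [negRev, List.mem_reverse, List.mem_map] at ha
    obtain ⟨c, hc, rfl⟩ := ha
    exact (h1.2.2 c hc b hb).neg_left
  · intro a ha
    simp only [negRev, List.mem_append, List.mem_reverse, List.mem_map] at ha
    rcases ha with ⟨c, hc, rfl⟩ | ha
    · have := h2 c (by simp [hc])
      omega
    · exact h2 a (by simp [ha])

lemma potential_append_two (u : List ℤ) (x a z : ℤ) (w : List ℤ) (hw : w ≠ []) :
    potential N (x :: u ++ a :: z :: w) = chain N (x :: u ++ [a]) + chain N (z :: w) + 2 * mark N a z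
      + agree (lastMark N (x :: u ++ [a])) (mark N a z) + agree (mark N a z) (firstMark N (z :: w))
      + firstMark N (x :: u ++ [a]) + lastMark N (z :: w) := by
  obtain ⟨y, w, rfl⟩ := List.exists_cons_of_ne_nil hw
  have e1 : firstMark N (x :: u ++ a :: z :: y :: w) = firstMark N (x :: u ++ [a]) := by
    cases u <;> rfl
  have e2 : lastMark N (x :: u ++ a :: z :: y :: w) = lastMark N (z :: y :: w) := by
    have := lastMark_append (N := N) (x :: u ++ [a]) z y w
    simpa using this
  rw [potential, chain_append, e1, e2]

lemma potential_append_last (u : List ℤ) (x a z : ℤ) :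
    potential N (x :: u ++ [a, z]) = chain N (x :: u ++ [a]) + 3 * mark N a z
      + agree (lastMark N (x :: u ++ [a])) (mark N a z) + firstMark N (x :: u ++ [a]) := by
  have e1 : firstMark N (x :: u ++ [a, z]) = firstMark N (x :: u ++ [a]) := by
    cases u <;> rfl
  have e2 : lastMark N (x :: u ++ [a, z]) = mark N a z := lastMark_concat _ _ _
  rw [potential, chain_append, e1, e2]
  simp only [chain, firstMark, agree_zero_right]
  ring

lemma potential_cons (a z : ℤ) (w : List ℤ) (hw : w ≠ []) :
    potential N (a :: z :: w) = chain N (z :: w) + 3 * mark N a z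
      + agree (mark N a z) (firstMark N (z :: w)) + lastMark N (z :: w) := by
  obtain ⟨y, w, rfl⟩ := List.exists_cons_of_ne_nil hw
  simp only [potential, chain, firstMark, lastMark]
  ring

lemma mark_mem (x y : ℤ) : -1 ≤ mark N x y ∧ mark N x y ≤ 1 := by
  unfold mark; split_ifs <;> simp

lemma mark_eq_one {x y : ℤ} : mark N x y = 1 ↔ y = x + 1 := by
  unfold mark; split_ifs <;> simp_all

lemma mark_eq_neg_one {x y : ℤ} :
    mark N x y = -1 ↔ y ≠ x + 1 ∧ (x = y + 1 ∨ (y = N ∧ x = 1 - N)) := by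
  unfold mark; split_ifs <;> simp_all

lemma eq_of_bounds {a : ℤ} (h : -1 ≤ a ∧ a ≤ 1) : a = -1 ∨ a = 0 ∨ a = 1 := by omega

lemma gain_inner_bound {m m' p q r : ℤ} (hm : -1 ≤ m ∧ m ≤ 1) (hm' : -1 ≤ m' ∧ m' ≤ 1)
    (hp : -1 ≤ p ∧ p ≤ 1) (hq : -1 ≤ q ∧ q ≤ 1) (hr : -1 ≤ r ∧ r ≤ 1)
    (c1 : ¬ (p = 1 ∧ m' = -1)) (c2 : ¬ (p = -1 ∧ m' = 1)) (c3 : ¬ (q = 1 ∧ m = -1))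
    (c4 : ¬ (q = -1 ∧ m = 1)) (c5 : ¬ (r = 1 ∧ m = -1)) (c6 : ¬ (r = -1 ∧ m = 1))
    (c7 : ¬ (r = 1 ∧ m' = -1)) (c8 : ¬ (r = -1 ∧ m' = 1)) (c9 : ¬ (m = 1 ∧ m' = 1))
    (c10 : ¬ (m = -1 ∧ m' = -1)) :
    2 * (m' - m) + agree p m' - agree q m + agree m' r - agree m r + q - p ≤ 4 ∧
    (2 * (m' - m) + agree p m' - agree q m + agree m' r - agree m r + q - p = 4 →
      m' = 1 ∨ m = -1 ∧ p = -1 ∧ r = -1) := by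
  rcases eq_of_bounds hm with rfl | rfl | rfl <;>
  rcases eq_of_bounds hm' with rfl | rfl | rfl <;>
  rcases eq_of_bounds hp with rfl | rfl | rfl <;>
  rcases eq_of_bounds hq with rfl | rfl | rfl <;>
  rcases eq_of_bounds hr with rfl | rfl | rfl <;>
  simp_all [agree]

lemma marks_not_opposite {x y z : ℤ} (hxz : x ≠ z) (hx : -N < x) (hy : y ≠ N) :
    ¬ (mark N x y = 1 ∧ mark N y z = -1) ∧ ¬ (mark N x y = -1 ∧ mark N y z = 1) := by
  simp only [mark_eq_one, mark_eq_neg_one]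
  omega

lemma marks_not_equal {x y z : ℤ} (hxy : x ≠ y) (hx : x < N) (hy : y < N) :
    ¬ (mark N x z = 1 ∧ mark N y z = 1) ∧ ¬ (mark N x z = -1 ∧ mark N y z = -1) := by
  simp only [mark_eq_one, mark_eq_neg_one]
  omega

lemma tight_of_mark_eq_one {x a z : ℤ} (hx : x ≠ 0) (hz : z ≠ 0) (h : mark N (-x) z = 1) :
    x ≠ 1 ∧ ¬ (a = 2 ∧ z = 1) := by
  rw [mark_eq_one] at h
  omega

lemma tight_of_mark_eq_neg_one {x y a z c : ℤ} (hy : y ≠ 0 ∧ y ≠ N) (hN : 0 < N) (hc : c ≠ 0)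
    (h1 : mark N x y = -1) (h2 : mark N z c = -1) : x ≠ 1 ∧ ¬ (a = 2 ∧ z = 1) := by
  rw [mark_eq_neg_one] at h1 h2
  omega

/-- A flip of the pancakes `x :: u ++ [a]` lying on `w ++ [N]`: the gain is at most `4`, and
equality forces restrictions on the junctions. -/
lemma gain_inner {x a z : ℤ} {u w : List ℤ} (h : Admissible N (x :: u ++ [a] ++ z :: w)) :
    potential N (negRev (x :: u ++ [a]) ++ z :: w ++ [N])
        ≤ potential N (x :: u ++ [a] ++ z :: w ++ [N]) + 4 ∧
      (potential N (negRev (x :: u ++ [a]) ++ z :: w ++ [N])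
        = potential N (x :: u ++ [a] ++ z :: w ++ [N]) + 4 →
        x ≠ 1 ∧ ¬ (a = 2 ∧ z = 1)) := by
  obtain ⟨hp, hr⟩ := h
  have hx := hr x (by simp)
  have ha := hr a (by simp)
  have hz := hr z (by simp)
  have hne : ∀ y ∈ x :: u ++ [a], y ≠ N ∧ -y ≠ N := by
    intro y hy
    have := hr y (by simp at hy ⊢; tauto)
    omega
  rw [List.pairwise_append] at hp
  obtain ⟨hp1, hp2, hp3⟩ := hp
  have hxa : Apart x a := by
    rw [List.cons_append, List.pairwise_cons] at hp1
    exact hp1.1 a (by simp)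
  have E1 : x :: u ++ [a] ++ z :: w ++ [N] = x :: u ++ a :: z :: (w ++ [N]) := by simp
  have E2 : negRev (x :: u ++ [a]) ++ z :: w ++ [N]
      = -a :: negRev u ++ -x :: z :: (w ++ [N]) := by simp [negRev]
  have E3 : negRev (x :: u ++ [a]) = -a :: negRev u ++ [-x] := by simp [negRev]
  rw [E1, E2, potential_append_two _ _ _ _ _ (by simp), potential_append_two _ _ _ _ _ (by simp),
    ← E3, chain_negRev _ hne, firstMark_negRev _ hne, lastMark_negRev _ hne]
  obtain ⟨y, t, hyt⟩ : ∃ y t, u ++ [a] = y :: t := by cases u <;> simp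
  obtain ⟨t', b, htb⟩ : ∃ t' b, x :: u = t' ++ [b] :=
    ⟨(x :: u).dropLast, (x :: u).getLast (by simp), (List.dropLast_append_getLast _).symm⟩
  obtain ⟨c, s, hcs⟩ : ∃ c s, w ++ [N] = c :: s := by cases w <;> simp
  have hc : c = N ∨ c ∈ z :: w := by
    have : c ∈ w ++ [N] := by simp [hcs]
    simp at this ⊢; tauto
  have hym : y ∈ x :: u ++ [a] := by simp [hyt]
  have hbm : b ∈ x :: u ++ [a] := by simp [htb]
  have hp : firstMark N (x :: u ++ [a]) = mark N x y := by
    rw [List.cons_append, hyt]; rfl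
  have hq : lastMark N (x :: u ++ [a]) = mark N b a := by
    rw [htb, List.append_assoc]; exact lastMark_concat _ _ _
  have hrr : firstMark N (z :: (w ++ [N])) = mark N z c := by rw [hcs]; rfl
  rw [hp, hq, hrr]
  have hyz := hp3 y hym z (by simp)
  have hbz := hp3 b hbm z (by simp)
  have hxz := hp3 x (by simp) z (by simp)
  have haz := hp3 a (by simp) z (by simp)
  have hyN := hr y (by rw [List.mem_append]; exact Or.inl hym)
  have hbN := hr b (by rw [List.mem_append]; exact Or.inl hbm)
  have hac : Apart a c := by
    rcases hc with rfl | hc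
    · exact apart_of_bounds ha
    · exact hp3 a (by simp) c hc
  have hxc : Apart x c := by
    rcases hc with rfl | hc
    · exact apart_of_bounds hx
    · exact hp3 x (by simp) c hc
  generalize chain N (x :: u ++ [a]) = C1
  generalize chain N (z :: (w ++ [N])) = C2
  generalize lastMark N (z :: (w ++ [N])) = C3
  have c1 : _ ∧ _ := marks_not_opposite (N := N) (x := -y) (y := -x) (z := z)
    hyz.neg_left.1 (by omega) (by omega)
  rw [mark_neg (by omega) (by omega)] at c1
  have c2 : _ ∧ _ := marks_not_opposite (N := N) hbz.1 hbN.2.1 ha.2.2.ne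
  have c3 : _ ∧ _ := marks_not_opposite (N := N) hac.1 ha.2.1 hz.2.2.ne
  have c4 : _ ∧ _ := marks_not_opposite (N := N) (x := -x) (y := z) (z := c)
    hxc.neg_left.1 (by omega) hz.2.2.ne
  have c5 : _ ∧ _ := marks_not_equal (N := N) (x := a) (y := -x) (z := z)
    hxa.symm.2 ha.2.2 (by omega)
  have b1 := mark_mem (N := N) x y
  have b2 := mark_mem (N := N) (-x) z
  have b3 := mark_mem (N := N) b a
  have b4 := mark_mem (N := N) a z
  have b5 := mark_mem (N := N) z c
  have key := gain_inner_bound b4 b2 b1 b3 b5 c1.1 c1.2 c2.1 c2.2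
    (fun h => c3.2 h.symm) (fun h => c3.1 h.symm) (fun h => c4.2 h.symm) (fun h => c4.1 h.symm)
    c5.1 c5.2
  refine ⟨by linarith [key.1], fun heq => ?_⟩
  have hc0 : c ≠ 0 := by
    rcases hc with rfl | hc
    · omega
    · exact (hr c (by rw [List.mem_append]; exact Or.inr hc)).1
  rcases key.2 (by linarith) with h | ⟨-, h1, h2⟩
  · exact tight_of_mark_eq_one hx.1 hz.1 h
  · exact tight_of_mark_eq_neg_one ⟨hyN.1, hyN.2.2.ne⟩ (by linarith) hc0 h1 h2

/-- A flip of the top pancake alone. -/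
lemma gain_single {a z : ℤ} {w : List ℤ} (h : Admissible N (a :: z :: w)) :
    potential N (-a :: z :: w ++ [N]) ≤ potential N (a :: z :: w ++ [N]) + 4 ∧
      (potential N (-a :: z :: w ++ [N]) = potential N (a :: z :: w ++ [N]) + 4 →
        a ≠ 1 ∧ ¬ (a = 2 ∧ z = 1)) := by
  obtain ⟨hp, hr⟩ := h
  have ha := hr a (by simp)
  have hz := hr z (by simp)
  obtain ⟨c, s, hcs⟩ : ∃ c s, w ++ [N] = c :: s := by cases w <;> simp
  have hc0 : c ≠ 0 := by
    have hc : c ∈ w ++ [N] := by simp [hcs]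
    rcases List.mem_append.1 hc with hc | hc
    · exact (hr c (by simp [hc])).1
    · rw [List.mem_singleton.1 hc]; omega
  simp only [List.cons_append]
  rw [potential_cons _ _ _ (by simp), potential_cons _ _ _ (by simp)]
  have hrr : firstMark N (z :: (w ++ [N])) = mark N z c := by rw [hcs]; rfl
  rw [hrr]
  have d1 : ¬ (mark N a z = -1 ∧ mark N (-a) z = 1) := by
    simp only [mark_eq_one, mark_eq_neg_one]
    omega
  have d2 : _ ∧ _ := marks_not_equal (N := N) (x := a) (y := -a) (z := z)
    (by omega) ha.2.2 (by omega)
  have b2 := mark_mem (N := N) (-a) z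
  have b4 := mark_mem (N := N) a z
  have b5 := mark_mem (N := N) z c
  have hm : (mark N a z = -1 → mark N z c = -1 → a ≠ 1 ∧ ¬ (a = 2 ∧ z = 1)) := by
    simp only [mark_eq_neg_one]
    omega
  have hm' : (mark N (-a) z = 1 → a ≠ 1 ∧ ¬ (a = 2 ∧ z = 1)) := by
    simp only [mark_eq_one]
    omega
  generalize mark N (-a) z = m' at *
  generalize mark N a z = m at *
  generalize mark N z c = r at *
  rcases eq_of_bounds b2 with rfl | rfl | rfl <;>
  rcases eq_of_bounds b4 with rfl | rfl | rfl <;>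
  rcases eq_of_bounds b5 with rfl | rfl | rfl <;>
  simp_all [agree] <;> omega

/-- A flip of the whole stack. -/
lemma gain_whole {x a : ℤ} {u : List ℤ} (h : Admissible N (x :: u ++ [a])) :
    potential N (negRev (x :: u ++ [a]) ++ [N]) ≤ potential N (x :: u ++ [a] ++ [N]) + 4 ∧
      (potential N (negRev (x :: u ++ [a]) ++ [N]) = potential N (x :: u ++ [a] ++ [N]) + 4 →
        x ≠ 1 ∧ ¬ (a = 2 ∧ N = 1)) := by
  obtain ⟨hp1, hr⟩ := h
  have hx := hr x (by simp)
  have ha := hr a (by simp)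
  have hne : ∀ y ∈ x :: u ++ [a], y ≠ N ∧ -y ≠ N := by
    intro y hy
    have := hr y hy
    omega
  have hxa : Apart x a := by
    rw [List.cons_append, List.pairwise_cons] at hp1
    exact hp1.1 a (by simp)
  have E1 : x :: u ++ [a] ++ [N] = x :: u ++ [a, N] := by simp
  have E2 : negRev (x :: u ++ [a]) ++ [N] = -a :: negRev u ++ [-x, N] := by simp [negRev]
  have E3 : negRev (x :: u ++ [a]) = -a :: negRev u ++ [-x] := by simp [negRev]
  rw [E1, E2, potential_append_last, potential_append_last,
    ← E3, chain_negRev _ hne, firstMark_negRev _ hne, lastMark_negRev _ hne]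
  obtain ⟨y, t, hyt⟩ : ∃ y t, u ++ [a] = y :: t := by cases u <;> simp
  obtain ⟨t', b, htb⟩ : ∃ t' b, x :: u = t' ++ [b] :=
    ⟨(x :: u).dropLast, (x :: u).getLast (by simp), (List.dropLast_append_getLast _).symm⟩
  have hp : firstMark N (x :: u ++ [a]) = mark N x y := by
    rw [List.cons_append, hyt]; rfl
  have hq : lastMark N (x :: u ++ [a]) = mark N b a := by
    rw [htb, List.append_assoc]; exact lastMark_concat _ _ _
  have hyN := hr y (by simp [hyt])
  have hbN := hr b (by simp [htb])
  rw [hp, hq]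
  have c1 : _ ∧ _ := marks_not_opposite (N := N) (x := -y) (y := -x) (z := N)
    (by omega) (by omega) (by omega)
  rw [mark_neg (by omega) (by omega)] at c1
  have c2 : _ ∧ _ := marks_not_opposite (N := N) (z := N) hbN.2.2.ne hbN.2.1 ha.2.2.ne
  have d1 : ¬ (mark N a N = -1 ∧ mark N (-x) N = 1) := by
    have := hxa.1
    simp only [mark_eq_one, mark_eq_neg_one]
    omega
  have d2 : _ ∧ _ := marks_not_equal (N := N) (x := a) (y := -x) (z := N)
    hxa.symm.2 ha.2.2 (by omega)
  have b1 := mark_mem (N := N) x y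
  have b2 := mark_mem (N := N) (-x) N
  have b3 := mark_mem (N := N) b a
  have b4 := mark_mem (N := N) a N
  have hm : (mark N x y = -1 → x ≠ 1 ∧ ¬ (a = 2 ∧ N = 1)) := by
    simp only [mark_eq_neg_one]
    omega
  have hm' : (mark N (-x) N = 1 → x ≠ 1 ∧ ¬ (a = 2 ∧ N = 1)) := by
    simp only [mark_eq_one]
    omega
  generalize mark N x y = p at *
  generalize mark N (-x) N = m' at *
  generalize mark N b a = q at *
  generalize mark N a N = m at *
  clear hp hq hp1 hr hne hyt htb E1 E2 E3
  rcases eq_of_bounds b2 with rfl | rfl | rfl <;>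
  rcases eq_of_bounds b4 with rfl | rfl | rfl <;>
  rcases eq_of_bounds b1 with rfl | rfl | rfl <;>
  rcases eq_of_bounds b3 with rfl | rfl | rfl <;>
  simp_all [agree] <;> omega

lemma gain_le {u w : List ℤ} (hu : u ≠ []) (hl : 2 ≤ (u ++ w).length)
    (h : Admissible N (u ++ w)) :
    potential N (negRev u ++ w ++ [N]) ≤ potential N (u ++ w ++ [N]) + 4 ∧
      (potential N (negRev u ++ w ++ [N]) = potential N (u ++ w ++ [N]) + 4 →
        u.head? ≠ some 1 ∧ ¬ (u.getLast? = some 2 ∧ w.head? = some 1)) := by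
  obtain ⟨x, u, rfl⟩ := List.exists_cons_of_ne_nil hu
  rcases List.eq_nil_or_concat u with rfl | ⟨u, a, rfl⟩
  · rcases w with _ | ⟨z, w⟩
    · simp at hl
    · simpa [negRev] using gain_single h
  · rw [List.concat_eq_append, ← List.cons_append] at *
    rcases w with _ | ⟨z, w⟩
    · have := gain_whole (N := N) (x := x) (a := a) (u := u) (by simpa using h)
      simp only [List.append_nil]
      refine ⟨this.1, fun e => ⟨?_, by simp⟩⟩
      simpa using (this.2 e).1
    · have := gain_inner (N := N) (x := x) (a := a) (u := u) (z := z) (w := w) h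
      refine ⟨this.1, fun e => ?_⟩
      have := this.2 e
      rw [List.getLast?_append]
      simpa using this

/-- An obstruction that survives every flip of maximal gain. -/
def Obstructed (s : List ℤ) : Prop :=
  (∃ p q, s = p ++ 2 :: 1 :: q) ∨ (∃ p q, s = p ++ -1 :: -2 :: q) ∨ (s.head? = some 1 ∧ -2 ∈ s)

lemma split_pair {p q u w : List ℤ} {a b : ℤ} (h : u ++ w = p ++ a :: b :: q) :
    (∃ r, u = p ++ a :: b :: r) ∨ (u.getLast? = some a ∧ w.head? = some b) ∨
      (∃ r, w = r ++ a :: b :: q) := by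
  rcases List.append_eq_append_iff.1 h with ⟨r, rfl, h2⟩ | ⟨r, rfl, h2⟩
  · exact Or.inr (Or.inr ⟨r, h2⟩)
  · rcases r with _ | ⟨c, _ | ⟨d, r⟩⟩
    · exact Or.inr (Or.inr ⟨[], by simpa using h2.symm⟩)
    · simp only [List.cons_append, List.nil_append, List.cons.injEq] at h2
      obtain ⟨rfl, rfl⟩ := h2
      exact Or.inr (Or.inl (by simp))
    · simp only [List.cons_append, List.cons.injEq] at h2
      obtain ⟨rfl, rfl, rfl⟩ := h2
      exact Or.inl ⟨r, rfl⟩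

lemma Obstructed.negRev_append {u w : List ℤ} (h : Obstructed (u ++ w)) (hu : u ≠ [])
    (h1 : u.head? ≠ some 1) (h2 : ¬ (u.getLast? = some 2 ∧ w.head? = some 1)) :
    Obstructed (negRev u ++ w) := by
  rcases h with ⟨p, q, h⟩ | ⟨p, q, h⟩ | ⟨h, -⟩
  · rcases split_pair h with ⟨r, rfl⟩ | h | ⟨r, rfl⟩
    · exact Or.inr (Or.inl ⟨negRev r, negRev p ++ w, by simp [negRev]⟩)
    · exact absurd h h2
    · exact Or.inl ⟨negRev u ++ r, q, by simp⟩
  · rcases split_pair h with ⟨r, rfl⟩ | ⟨h3, h4⟩ | ⟨r, rfl⟩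
    · exact Or.inl ⟨negRev r, negRev p ++ w, by simp [negRev]⟩
    · right; right
      rw [List.getLast?_eq_some_iff] at h3
      obtain ⟨t, rfl⟩ := h3
      have : -2 ∈ w := List.mem_of_mem_head? h4
      exact ⟨by simp [negRev], by simp [this]⟩
    · exact Or.inr (Or.inl ⟨negRev u ++ r, q, by simp⟩)
  · rw [List.head?_append_of_ne_nil _ hu] at h
    exact absurd h h1

lemma pancakeFlip_eq (k : ℕ) (s : List ℤ) : pancakeFlip k s = negRev (s.take k) ++ s.drop k := rfl

lemma applyFlips_bound (ks : List ℕ) (hk : ∀ k ∈ ks, 1 ≤ k) {s : List ℤ} (hl : 2 ≤ s.length)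
    (h : Admissible N s) :
    potential N (applyFlips ks s ++ [N]) ≤ potential N (s ++ [N]) + 4 * ks.length ∧
      (Obstructed s → ¬ Obstructed (applyFlips ks s) →
        potential N (applyFlips ks s ++ [N]) < potential N (s ++ [N]) + 4 * ks.length) := by
  induction ks generalizing s with
  | nil => exact ⟨by simp [applyFlips], fun h1 h2 => absurd h1 h2⟩
  | cons k ks ih =>
    have hne : s.take k ≠ [] := by
      have := hk k (by simp)
      rw [← List.length_pos_iff, List.length_take]
      omega
    have hs := List.take_append_drop k s
    have hgain := gain_le (N := N) (w := s.drop k) hne (by rw [hs]; exact hl) (by rw [hs]; exact h)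
    rw [hs, ← pancakeFlip_eq] at hgain
    have hadm : Admissible N (pancakeFlip k s) := by
      rw [← hs] at h
      exact h.negRev_append
    have hlen : 2 ≤ (pancakeFlip k s).length := by
      have := congrArg List.length hs
      simp only [List.length_append] at this
      simp only [pancakeFlip_eq, negRev, List.length_append, List.length_reverse, List.length_map]
      omega
    obtain ⟨i1, i2⟩ := ih (fun k hk' => hk k (by simp [hk'])) hlen hadm
    have e : applyFlips (k :: ks) s = applyFlips ks (pancakeFlip k s) := rfl
    rw [e]
    push_cast [List.length_cons]
    refine ⟨by linarith [hgain.1], fun ho hno => ?_⟩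
    rcases hgain.1.lt_or_eq with hlt | heq
    · linarith
    · have := i2 (by
        have := (hgain.2 heq)
        rw [pancakeFlip_eq]
        exact Obstructed.negRev_append (by rwa [hs]) hne this.1 this.2) hno
      linarith

end

lemma sortedStack_eq (n : ℕ) : sortedStack n = (List.range n).map fun i : ℕ => (i : ℤ) + 1 := by
  simp [sortedStack, ← List.map_eq_flatMap]

lemma burntStack_eq (n : ℕ) : burntStack n = (List.range n).map fun i : ℕ => -((i : ℤ) + 1) := by
  simp [burntStack, ← List.map_eq_flatMap]

lemma potential_run {N c : ℤ} (x y : ℤ) (l : List ℤ)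
    (h : (x :: y :: l).IsChain fun a b => mark N a b = c) :
    potential N (x :: y :: l) = c * (3 * l.length + 4) := by
  have key : chain N (x :: y :: l) = c * (3 * l.length + 2) ∧ lastMark N (x :: y :: l) = c := by
    induction l generalizing x y with
    | nil =>
      simp only [List.isChain_cons_cons] at h
      simp [chain, firstMark, lastMark, agree_zero_right, h.1]
      ring
    | cons z l ih =>
      rw [List.isChain_cons_cons] at h
      obtain ⟨i1, i2⟩ := ih y z h.2
      have h2 := (List.isChain_cons_cons.1 h.2).1
      refine ⟨?_, i2⟩
      rw [chain, i1]
      simp only [firstMark, h.1, h2, agree, if_true]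
      push_cast [List.length_cons]
      ring
  have h1 : mark N x y = c := (List.isChain_cons_cons.1 h).1
  simp only [potential, key.1, key.2, firstMark, h1]
  ring

lemma potential_sortedStack (n : ℕ) (hn : 1 ≤ n) :
    potential (n + 1) (sortedStack n ++ [(n : ℤ) + 1]) = 3 * n + 1 := by
  have e : sortedStack n ++ [(n : ℤ) + 1] = sortedStack (n + 1) := by
    simp [sortedStack_eq, List.range_succ]
  obtain ⟨m, rfl⟩ : ∃ m, n = m + 1 := ⟨n - 1, by omega⟩
  rw [e]
  have h : (sortedStack (m + 1 + 1)).IsChain fun a b => mark ((m + 1 : ℕ) + 1) a b = 1 := by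
    rw [List.isChain_iff_getElem]
    intro i hi
    simp [sortedStack_eq, mark]
  have hlen : (sortedStack (m + 1 + 1)).length = m + 2 := by simp [sortedStack_eq]
  rcases hs : sortedStack (m + 1 + 1) with _ | ⟨x, _ | ⟨y, l⟩⟩
  · rw [hs] at hlen; simp at hlen
  · rw [hs] at hlen; simp at hlen
  · rw [hs] at h hlen
    rw [potential_run x y l h]
    simp only [List.length_cons] at hlen
    have : (l.length : ℤ) = m := by exact_mod_cast (by omega : l.length = m)
    push_cast
    linarith

lemma potential_burntStack (n : ℕ) (hn : 1 ≤ n) :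
    potential (n + 1) (burntStack n ++ [(n : ℤ) + 1]) = -(3 * n + 1) := by
  obtain ⟨m, rfl⟩ : ∃ m, n = m + 1 := ⟨n - 1, by omega⟩
  have h : (burntStack (m + 1) ++ [((m + 1 : ℕ) : ℤ) + 1]).IsChain
      fun a b => mark ((m + 1 : ℕ) + 1) a b = -1 := by
    rw [List.isChain_append]
    refine ⟨?_, by simp, ?_⟩
    · rw [List.isChain_iff_getElem]
      intro i hi
      simp only [burntStack_eq, List.getElem_map, List.getElem_range, mark]
      push_cast
      rw [if_neg (by omega), if_pos (by omega)]
    · simp [burntStack_eq, List.range_succ, mark]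
      omega
  have hlen : (burntStack (m + 1) ++ [((m + 1 : ℕ) : ℤ) + 1]).length = m + 2 := by
    simp [burntStack_eq]
  rcases hs : burntStack (m + 1) ++ [((m + 1 : ℕ) : ℤ) + 1] with _ | ⟨x, _ | ⟨y, l⟩⟩
  · rw [hs] at hlen; simp at hlen
  · rw [hs] at hlen; simp at hlen
  · rw [hs] at h hlen
    rw [potential_run x y l h]
    simp only [List.length_cons] at hlen
    have : (l.length : ℤ) = m := by exact_mod_cast (by omega : l.length = m)
    push_cast
    linarith

lemma admissible_burntStack (n : ℕ) : Admissible (n + 1) (burntStack n) := by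
  constructor
  · rw [burntStack_eq, List.pairwise_map]
    exact List.pairwise_lt_range.imp fun {a b} h => ⟨by omega, by omega⟩
  · intro x hx
    simp only [burntStack_eq, List.mem_map, List.mem_range] at hx
    omega

lemma obstructed_burntStack (n : ℕ) (hn : 2 ≤ n) : Obstructed (burntStack n) := by
  obtain ⟨m, rfl⟩ : ∃ m, n = m + 2 := ⟨n - 2, by omega⟩
  refine Or.inr (Or.inl ⟨[], (List.range m).map fun i : ℕ => -((i : ℤ) + 3), ?_⟩)
  simp [burntStack_eq, List.range_succ_eq_map, Function.comp_def]
  intros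
  ring

lemma not_obstructed_sortedStack (n : ℕ) : ¬ Obstructed (sortedStack n) := by
  have hpos : ∀ x ∈ sortedStack n, 0 < x := by
    simp only [sortedStack_eq, List.mem_map]
    rintro _ ⟨i, -, rfl⟩
    positivity
  have hlt : (sortedStack n).Pairwise (· < ·) := by
    rw [sortedStack_eq, List.pairwise_map]
    exact List.pairwise_lt_range.imp fun {a b} h => by omega
  rintro (⟨p, q, h⟩ | ⟨p, q, h⟩ | ⟨-, h⟩)
  · rw [h, List.pairwise_append] at hlt
    simp at hlt
  · have := hpos (-1) (by rw [h]; simp)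
    omega
  · have := hpos _ h
    omega

/-- Sorting `[-1, ..., -n]` takes strictly more than `(3 n + 1) / 2` flips. -/
theorem lt_length_of_isSortingSeq {n : ℕ} (hn : 2 ≤ n) {ks : List ℕ} (h : IsSortingSeq n ks) :
    3 * n + 1 < 2 * ks.length := by
  have := (applyFlips_bound (N := n + 1) ks (fun k hk => (h.1 k hk).1) (s := burntStack n)
    (by simpa [burntStack_eq] using hn) (admissible_burntStack n)).2 (obstructed_burntStack n hn)
    (by rw [h.2]; exact not_obstructed_sortedStack n)
  rw [h.2, potential_sortedStack n (by omega), potential_burntStack n (by omega)] at this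
  omega

lemma negRev_nil : negRev [] = [] := rfl

lemma negRev_cons (a : ℤ) (u : List ℤ) : negRev (a :: u) = negRev u ++ [-a] := by simp [negRev]

lemma negRev_app (u v : List ℤ) : negRev (u ++ v) = negRev v ++ negRev u := by simp [negRev]

lemma negRev_invol (u : List ℤ) : negRev (negRev u) = u := by simp [negRev]

/-- The stack `t` is reached from the stack `s` by exactly `k` flips of legal sizes. -/
def Reach (k : ℕ) (s t : List ℤ) : Prop :=
  ∃ ks : List ℕ, ks.length = k ∧ (∀ x ∈ ks, 1 ≤ x ∧ x ≤ s.length) ∧ applyFlips ks s = t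

lemma length_pancakeFlip (k : ℕ) (l : List ℤ) : (pancakeFlip k l).length = l.length := by
  simp [pancakeFlip]
  omega

lemma length_applyFlips (ks : List ℕ) (l : List ℤ) : (applyFlips ks l).length = l.length := by
  induction ks generalizing l with
  | nil => rfl
  | cons k ks ih => exact (ih _).trans (length_pancakeFlip k l)

namespace Reach

lemma refl (s : List ℤ) : Reach 0 s s := ⟨[], rfl, by simp, rfl⟩

lemma trans {a b : ℕ} {s t u : List ℤ} (h₁ : Reach a s t) (h₂ : Reach b t u) :
    Reach (a + b) s u := by
  obtain ⟨ks, rfl, hk, rfl⟩ := h₁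
  obtain ⟨ls, rfl, hl, rfl⟩ := h₂
  refine ⟨ks ++ ls, by simp, fun x hx => ?_, by simp [applyFlips]⟩
  rcases List.mem_append.1 hx with h | h
  · exact hk x h
  · simpa [length_applyFlips] using hl x h

lemma trans_eq {a b : ℕ} {s s' t t' u : List ℤ} (h₁ : Reach a s t) (hs : s' = s) (ht : t = t')
    (h₂ : Reach b t' u) : Reach (a + b) s' u := hs ▸ (ht ▸ h₁).trans h₂

lemma flip {u : List ℤ} (hu : u ≠ []) (v : List ℤ) : Reach 1 (u ++ v) (negRev u ++ v) := by
  refine ⟨[u.length], rfl, ?_, by simp [applyFlips, pancakeFlip, negRev]⟩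
  have := List.length_pos_iff.2 hu
  simp
  omega

end Reach

lemma negRev_flatMap {f : ℤ → List ℤ} (hf : ∀ x, f (-x) = negRev (f x)) (u : List ℤ) :
    (negRev u).flatMap f = negRev (u.flatMap f) := by
  induction u with
  | nil => rfl
  | cons a u ih => simp [negRev_cons, negRev_app, ih, hf]

/-- Replacing every pancake by a nonempty block carries flips to flips. -/
lemma reach_flatMap {f : ℤ → List ℤ} (hf : ∀ x, f (-x) = negRev (f x)) (h0 : ∀ x, f x ≠ [])
    (ks : List ℕ) (hk : ∀ k ∈ ks, 1 ≤ k) (s : List ℤ) (hs : s ≠ []) :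
    Reach ks.length (s.flatMap f) ((applyFlips ks s).flatMap f) := by
  induction ks generalizing s with
  | nil => exact Reach.refl _
  | cons k ks ih =>
    have h1 : Reach 1 (s.flatMap f) ((pancakeFlip k s).flatMap f) := by
      have hu : (s.take k).flatMap f ≠ [] := by
        have := hk k (by simp)
        rcases s with _ | ⟨a, s⟩
        · exact absurd rfl hs
        · rcases k with _ | k
          · omega
          · simp [h0 a]
      have := Reach.flip hu ((s.drop k).flatMap f)
      rwa [← negRev_flatMap hf, ← List.flatMap_append, List.take_append_drop,
        ← List.flatMap_append] at this
    have h2 := ih (fun x hx => hk x (by simp [hx])) (pancakeFlip k s) (by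
      rw [ne_eq, ← List.length_eq_zero_iff, length_pancakeFlip]
      simpa using hs)
    rw [List.length_cons, Nat.add_comm]
    exact h1.trans h2

/-- Pancakes `c` become the block `B`, and pancakes from `19` on move down by `N` places. -/
def expand (N c : ℤ) (B : List ℤ) (x : ℤ) : List ℤ :=
  if x = c then B else if x = -c then negRev B else
    if 19 ≤ x then [x + N] else if x ≤ -19 then [x - N] else [x]

lemma expand_neg {N c : ℤ} (hc : c ≠ 0) (B : List ℤ) (x : ℤ) :
    expand N c B (-x) = negRev (expand N c B x) := by
  unfold expand
  split_ifs <;> first | omega | simp [negRev] <;> omega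

lemma expand_ne_nil (N c : ℤ) {B : List ℤ} (hB : B ≠ []) (x : ℤ) : expand N c B x ≠ [] := by
  unfold expand
  split_ifs <;> simp_all [negRev]

lemma reach_expand (N : ℤ) {c : ℤ} (hc : c ≠ 0) {B : List ℤ} (hB : B ≠ []) {k : ℕ} {s t : List ℤ}
    (ks : List ℕ) (hs : s ≠ []) (hk : (∀ k ∈ ks, 1 ≤ k) ∧ ks.length = k ∧ applyFlips ks s = t) :
    Reach k (s.flatMap (expand N c B)) (t.flatMap (expand N c B)) := by
  obtain ⟨h, rfl, rfl⟩ := hk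
  exact reach_flatMap (expand_neg hc B) (expand_ne_nil N c hB) ks h s hs

/-- The descending block `-12, -13, ..., -(19 + 4 j)`. -/
def downBlock : ℕ → List ℤ
  | 0 => [-12, -13, -14, -15, -16, -17, -18, -19]
  | j + 1 => downBlock j ++ [-(4 * (j : ℤ) + 20), -(4 * j + 21), -(4 * j + 22), -(4 * j + 23)]

/-- The ascending block `15, 16, ..., 20 + 4 j`. -/
def upBlock : ℕ → List ℤ
  | 0 => [15, 16, 17, 18, 19, 20]
  | j + 1 => upBlock j ++ [4 * (j : ℤ) + 21, 4 * j + 22, 4 * j + 23, 4 * j + 24]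

/-- The pairs `-(20 + 4 i), -(21 + 4 i)` for `i < j`, with decreasing `i`. -/
def lowPairs : ℕ → List ℤ
  | 0 => []
  | j + 1 => [-(4 * (j : ℤ) + 20), -(4 * j + 21)] ++ lowPairs j

/-- The pairs `-(22 + 4 i), -(23 + 4 i)` for `i < j`, with increasing `i`. -/
def highPairs : ℕ → List ℤ
  | 0 => []
  | j + 1 => highPairs j ++ [-(4 * (j : ℤ) + 22), -(4 * j + 23)]

/-- The quadruples `21 + 4 i, 22 + 4 i, 19 + 4 i, 20 + 4 i` for `i < j`, with increasing `i`. -/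
def swappedPairs : ℕ → List ℤ
  | 0 => []
  | j + 1 => swappedPairs j ++ [4 * (j : ℤ) + 21, 4 * j + 22, 4 * j + 19, 4 * j + 20]

/-- Splitting the descending block into interleaved pairs. -/
lemma reach_split (j : ℕ) (X Q W : List ℤ) :
    Reach (2 * j + 1) (negRev Q ++ negRev X ++ downBlock j ++ W)
      ([17, 16, 15, 14, 13, 12] ++ X ++ Q ++ lowPairs j ++ [-18, -19] ++ highPairs j ++ W) := by
  induction j generalizing Q W with
  | zero =>
    have := Reach.flip (u := negRev Q ++ negRev X ++ [-12, -13, -14, -15, -16, -17]) (by simp)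
      ([-18, -19] ++ W)
    simpa [downBlock, lowPairs, highPairs, negRev_app, negRev_invol, negRev_cons, negRev_nil]
      using this
  | succ j ih =>
    have hD : downBlock j ≠ [] := by cases j <;> simp [downBlock]
    have h1 := Reach.flip (u := negRev Q ++ negRev X ++ downBlock j) (by simp [hD])
      ([-(4 * (j : ℤ) + 20), -(4 * j + 21), -(4 * j + 22), -(4 * j + 23)] ++ W)
    have h2 := Reach.flip
      (u := negRev (downBlock j) ++ X ++ Q ++ [-(4 * (j : ℤ) + 20), -(4 * j + 21)]) (by simp)
      ([-(4 * (j : ℤ) + 22), -(4 * j + 23)] ++ W)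
    have h3 := ih (Q ++ [-(4 * (j : ℤ) + 20), -(4 * j + 21)])
      ([-(4 * (j : ℤ) + 22), -(4 * j + 23)] ++ W)
    rw [show 2 * (j + 1) + 1 = 1 + (1 + (2 * j + 1)) by ring]
    simp only [downBlock, lowPairs, highPairs, negRev_app, negRev_invol, negRev_cons, negRev_nil,
      List.append_assoc, List.cons_append, List.nil_append, neg_neg] at h1 h2 h3 ⊢
    exact h1.trans (h2.trans h3)

/-- Joining the interleaved pairs, up to the order of the resulting pairs. -/
lemma reach_link (j : ℕ) (A V : List ℤ) :
    Reach (2 * j) (-19 :: (highPairs j ++ A ++ [17, 18] ++ negRev (lowPairs j) ++ V))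
      (-(4 * j + 19) :: (A ++ [17, 18] ++ swappedPairs j ++ V)) := by
  induction j generalizing A V with
  | zero => simpa [highPairs, lowPairs, swappedPairs, negRev_nil] using Reach.refl _
  | succ j ih =>
    have h1 := ih ([-(4 * (j : ℤ) + 22), -(4 * j + 23)] ++ A)
      ([4 * (j : ℤ) + 21, 4 * j + 20] ++ V)
    have h2 := Reach.flip (u := [-(4 * (j : ℤ) + 19), -(4 * (j : ℤ) + 22), -(4 * j + 23)] ++ A ++
      [17, 18] ++ swappedPairs j ++ [4 * (j : ℤ) + 21]) (by simp) ([4 * (j : ℤ) + 20] ++ V)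
    have h3 := Reach.flip (u := [-(4 * (j : ℤ) + 21)] ++ negRev (swappedPairs j) ++ [-18, -17] ++
      negRev A ++ [4 * (j : ℤ) + 23]) (by simp)
      ([4 * (j : ℤ) + 22, 4 * (j : ℤ) + 19, 4 * (j : ℤ) + 20] ++ V)
    rw [show 2 * (j + 1) = 2 * j + (1 + 1) by ring,
      show (4 * ((j + 1 : ℕ) : ℤ) + 19) = 4 * j + 23 by push_cast; ring]
    simp only [highPairs, lowPairs, swappedPairs, negRev_app, negRev_invol, negRev_cons, negRev_nil,
      List.append_assoc, List.cons_append, List.nil_append, neg_neg] at h1 h2 h3 ⊢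
    exact h1.trans (h2.trans h3)

/-- Merging the swapped pairs into one block. -/
lemma reach_merge (j : ℕ) (F V : List ℤ) :
    Reach (2 * j + 1)
      ([4 * (j : ℤ) + 19, 4 * j + 20] ++ F ++ negRev ([17, 18] ++ swappedPairs j) ++ [-16, -15] ++ V)
      (negRev F ++ negRev (upBlock j) ++ V) := by
  induction j generalizing F V with
  | zero =>
    have := Reach.flip (u := [19, 20] ++ F) (by simp) ([-18, -17, -16, -15] ++ V)
    simpa [swappedPairs, upBlock, negRev_app, negRev_cons, negRev_nil] using this
  | succ j ih =>
    have h1 := Reach.flip (u := [4 * (j : ℤ) + 23, 4 * j + 24] ++ F ++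
      [-(4 * (j : ℤ) + 20), -(4 * j + 19)]) (by simp)
      ([-(4 * (j : ℤ) + 22), -(4 * j + 21)] ++ negRev ([17, 18] ++ swappedPairs j) ++
        [-16, -15] ++ V)
    have h2 := ih (negRev F ++
      [-(4 * (j : ℤ) + 24), -(4 * j + 23), -(4 * j + 22), -(4 * j + 21)]) V
    have h3 := Reach.flip (u := [4 * (j : ℤ) + 21, 4 * j + 22, 4 * j + 23, 4 * j + 24] ++ F)
      (by simp) (negRev (upBlock j) ++ V)
    rw [show 2 * (j + 1) + 1 = 1 + ((2 * j + 1) + 1) by ring,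
      show (4 * ((j + 1 : ℕ) : ℤ) + 19) = 4 * j + 23 by push_cast; ring,
      show (4 * ((j + 1 : ℕ) : ℤ) + 20) = 4 * j + 24 by push_cast; ring]
    simp only [swappedPairs, upBlock, negRev_app, negRev_invol, negRev_cons, negRev_nil,
      List.append_assoc, List.cons_append, List.nil_append, neg_neg] at h1 h2 h3 ⊢
    exact h1.trans (h2.trans h3)

lemma burntStack_eq_downBlock (j : ℕ) : burntStack (4 * j + 29) =
    [-1, -2, -3, -4, -5, -6, -7, -8, -9, -10, -11] ++ downBlock j ++
      [-20 - 4 * (j : ℤ), -21 - 4 * j, -22 - 4 * j, -23 - 4 * j, -24 - 4 * j, -25 - 4 * j,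
        -26 - 4 * j, -27 - 4 * j, -28 - 4 * j, -29 - 4 * j] := by
  have h : ∀ j : ℕ, (List.range (4 * j + 19)).map (fun i : ℕ => -((i : ℤ) + 1)) =
      [-1, -2, -3, -4, -5, -6, -7, -8, -9, -10, -11] ++ downBlock j := by
    intro j
    induction j with
    | zero => decide
    | succ j ih =>
      rw [show 4 * (j + 1) + 19 = 4 * j + 19 + 1 + 1 + 1 + 1 by ring]
      obtain ⟨m, hm⟩ : ∃ m, m = 4 * j + 19 := ⟨_, rfl⟩
      rw [← hm] at ih ⊢
      have hz : (m : ℤ) = 4 * j + 19 := by rw [hm]; push_cast; ring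
      simp only [List.range_succ, List.map_append, List.map_cons, List.map_nil, ih, downBlock,
        List.append_assoc, List.cons_append, List.nil_append, Nat.cast_add, Nat.cast_one, hz]
      ring_nf
  rw [burntStack_eq, ← h]
  simp [List.range_succ]
  refine ⟨?_, ?_, ?_, ?_, ?_, ?_, ?_, ?_, ?_, ?_⟩ <;> ring

lemma sortedStack_eq_upBlock (j : ℕ) : sortedStack (4 * j + 29) =
    [1, 2, 3, 4, 5, 6, 7, 8, 9, 10, 11, 12, 13, 14] ++ upBlock j ++
      [21 + 4 * (j : ℤ), 22 + 4 * j, 23 + 4 * j, 24 + 4 * j, 25 + 4 * j, 26 + 4 * j,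
        27 + 4 * j, 28 + 4 * j, 29 + 4 * j] := by
  have h : ∀ j : ℕ, (List.range (4 * j + 20)).map (fun i : ℕ => (i : ℤ) + 1) =
      [1, 2, 3, 4, 5, 6, 7, 8, 9, 10, 11, 12, 13, 14] ++ upBlock j := by
    intro j
    induction j with
    | zero => decide
    | succ j ih =>
      rw [show 4 * (j + 1) + 20 = 4 * j + 20 + 1 + 1 + 1 + 1 by ring]
      obtain ⟨m, hm⟩ : ∃ m, m = 4 * j + 20 := ⟨_, rfl⟩
      rw [← hm] at ih ⊢
      have hz : (m : ℤ) = 4 * j + 20 := by rw [hm]; push_cast; ring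
      simp [List.range_succ, ih, upBlock]
      omega
  rw [sortedStack_eq, ← h]
  simp [List.range_succ]
  refine ⟨?_, ?_, ?_, ?_, ?_, ?_, ?_, ?_, ?_⟩ <;> ring

lemma reach_sortedStack (j : ℕ) :
    Reach (6 * j + 45) (burntStack (4 * j + 29)) (sortedStack (4 * j + 29)) := by
  have e1 := reach_expand (4 * j) (c := -12) (B := downBlock j) (by norm_num)
    (by cases j <;> simp [downBlock])
    (s := [-1, -2, -3, -4, -5, -6, -7, -8, -9, -10, -11, -12, -20, -21, -22, -23, -24, -25, -26,
      -27, -28, -29])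
    (t := [-10, -11, 9, 8, 7, 6, 5, 4, -12, 29, 28, 27, 26, -20, -21, -22, -23, -24, -25, 3, 2, 1])
    [22, 10, 6, 19, 8, 2] (by simp) ⟨by decide, rfl, by decide⟩
  have e2 := reach_split j [-4, -5, -6, -7, -8, -9, 11, 10] []
    ([29 + 4 * (j : ℤ), 28 + 4 * j, 27 + 4 * j, 26 + 4 * j, -20 - 4 * j, -21 - 4 * j, -22 - 4 * j,
      -23 - 4 * j, -24 - 4 * j, -25 - 4 * j, 3, 2, 1])
  have e3 := reach_expand (4 * j) (c := -18) (B := lowPairs j ++ [-18, -19] ++ highPairs j)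
    (by norm_num) (by simp)
    (s := [17, 16, 15, 14, 13, 12, -4, -5, -6, -7, -8, -9, 11, 10, -18, 29, 28, 27, 26, -20, -21,
      -22, -23, -24, -25, 3, 2, 1])
    (t := [-17, -6, -5, 27, 26, -20, -21, -14, -13, 1, 2, 23, 22, -8, -7, -28, -29, 18, -10, -9,
      11, 12, -4, -3, 25, 24, 15, 16])
    [8, 17, 7, 21, 8, 27, 4, 17, 28, 14, 10, 25, 7, 2, 13, 19, 27] (by simp)
    ⟨by decide, rfl, by decide⟩
  have e4 := Reach.flip (u := [-17, -6, -5, 27 + 4 * (j : ℤ), 26 + 4 * j, -20 - 4 * j, -21 - 4 * j,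
      -14, -13, 1, 2, 23 + 4 * j, 22 + 4 * j, -8, -7, -28 - 4 * j, -29 - 4 * j] ++
      negRev (highPairs j) ++ [19]) (by simp)
    ([18] ++ negRev (lowPairs j) ++ [-10, -9, 11, 12, -4, -3, 25 + 4 * (j : ℤ), 24 + 4 * j, 15, 16])
  have e5 := reach_link j [29 + 4 * (j : ℤ), 28 + 4 * j, 7, 8, -22 - 4 * j, -23 - 4 * j, -2, -1,
      13, 14, 21 + 4 * j, 20 + 4 * j, -26 - 4 * j, -27 - 4 * j, 5, 6]
    [-10, -9, 11, 12, -4, -3, 25 + 4 * (j : ℤ), 24 + 4 * j, 15, 16]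
  have e6 := reach_expand (4 * j) (c := 17) (B := [17, 18] ++ swappedPairs j) (by norm_num)
    (by simp)
    (s := [-19, 29, 28, 7, 8, -22, -23, -2, -1, 13, 14, 21, 20, -26, -27, 5, 6, 17, -10, -9, 11, 12,
      -4, -3, 25, 24, 15, 16])
    (t := [19, 20, -26, -25, 3, 4, -12, -11, 9, 10, -17, -16, -15, -24, -23, -2, -1, 13, 14, 21, 22,
      -8, -7, -6, -5, 27, 28, 29])
    [12, 6, 25, 11, 15, 28, 16, 4, 27] (by simp) ⟨by decide, rfl, by decide⟩
  have e7 := reach_merge j [-26 - 4 * (j : ℤ), -25 - 4 * j, 3, 4, -12, -11, 9, 10]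
    [-24 - 4 * (j : ℤ), -23 - 4 * j, -2, -1, 13, 14, 21 + 4 * j, 22 + 4 * j, -8, -7, -6, -5,
      27 + 4 * j, 28 + 4 * j, 29 + 4 * j]
  have e8 := reach_expand (4 * j) (c := 15) (B := upBlock j) (by norm_num)
    (by cases j <;> simp [upBlock])
    (s := [-10, -9, 11, 12, -4, -3, 25, 26, -15, -24, -23, -2, -1, 13, 14, 21, 22, -8, -7, -6, -5,
      27, 28, 29])
    (t := [1, 2, 3, 4, 5, 6, 7, 8, 9, 10, 11, 12, 13, 14, 15, 21, 22, 23, 24, 25, 26, 27, 28, 29])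
    [2, 17, 6, 11, 3, 7, 6, 21, 8, 12] (by simp) ⟨by decide, rfl, by decide⟩
  rw [burntStack_eq_downBlock, sortedStack_eq_upBlock]
  rw [show 6 * j + 45 =
    6 + ((2 * j + 1) + (17 + (1 + (2 * j + (9 + ((2 * j + 1) + (10 + 0))))))) by ring]
  refine e1.trans_eq ?_ ?_ <| e2.trans_eq rfl ?_ <| e3.trans_eq rfl ?_ <| e4.trans_eq rfl ?_ <|
    e5.trans_eq rfl ?_ <| e6.trans_eq rfl ?_ <| e7.trans_eq rfl ?_ <| e8.trans_eq rfl ?_ <|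
    Reach.refl _
  all_goals simp [expand, negRev_app, negRev_invol, negRev_cons, negRev_nil]
  all_goals try ring_nf
  all_goals try simp

end BurntPancake

/-- (Main Theorem) For every integer `n ≥ 29` with `n ≡ 1 (mod 4)`, `T n = (3n+3)/2`. -/
theorem T_eq_of_one_mod_four (n : ℕ) (hn : 29 ≤ n) (hmod : n % 4 = 1) :
    T n = (3 * n + 3) / 2 := by
  obtain ⟨j, rfl⟩ : ∃ j, n = 4 * j + 29 := ⟨(n - 29) / 4, by omega⟩
  obtain ⟨ks, hlen, hks, hsort⟩ := BurntPancake.reach_sortedStack j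
  have hmem : (3 * (4 * j + 29) + 3) / 2 ∈
      {m | ∃ ks : List ℕ, IsSortingSeq (4 * j + 29) ks ∧ ks.length = m} :=
    ⟨ks, ⟨by simpa [BurntPancake.burntStack_eq] using hks, hsort⟩, by omega⟩
  refine le_antisymm (Nat.sInf_le hmem) (le_csInf ⟨_, hmem⟩ ?_)
  rintro _ ⟨ls, hls, rfl⟩
  have := BurntPancake.lt_length_of_isSortingSeq (by omega) hls
  omega
end

section
/- For every integer n ≥ 29 with n ≡ 1 (mod 4), there exists a sequence of at most (3n+3)/2 flips transforming the burnt stack Ī_n = [-1, -2, ..., -n] into the sorted stack I_n = [1, 2, ..., n]; equivalently, T(n) ≤ (3n+3)/2. -/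
/-! ### Sequences of flips -/

/-- A list turned upside down: reversed, with all signs changed. -/
def turnOver (l : List ℤ) : List ℤ := (l.map Neg.neg).reverse

@[simp] lemma turnOver_nil : turnOver [] = [] := rfl

@[simp] lemma turnOver_append (a b : List ℤ) :
    turnOver (a ++ b) = turnOver b ++ turnOver a := by
  simp [turnOver]

@[simp] lemma turnOver_cons (x : ℤ) (l : List ℤ) :
    turnOver (x :: l) = turnOver l ++ [-x] := by
  simp [turnOver]

@[simp] lemma turnOver_turnOver (l : List ℤ) : turnOver (turnOver l) = l := by
  simp [turnOver]

lemma pancakeFlip_eq (k : ℕ) (l : List ℤ) :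
    pancakeFlip k l = turnOver (l.take k) ++ l.drop k := rfl

lemma length_pancakeFlip (k : ℕ) (l : List ℤ) : (pancakeFlip k l).length = l.length := by
  simp [pancakeFlip]
  omega

lemma length_applyFlips (ks : List ℕ) (l : List ℤ) : (applyFlips ks l).length = l.length := by
  induction ks generalizing l with
  | nil => rfl
  | cons k ks ih => exact (ih _).trans (length_pancakeFlip k l)

/-- `Reach m s t` means that at most `m` (nonempty) flips transform the stack `s` into `t`. -/
def Reach (m : ℕ) (s t : List ℤ) : Prop :=
  ∃ ks : List ℕ, (∀ k ∈ ks, 1 ≤ k ∧ k ≤ s.length) ∧ applyFlips ks s = t ∧ ks.length ≤ m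

lemma Reach.refl (s : List ℤ) : Reach 0 s s := ⟨[], by simp, rfl, le_rfl⟩

lemma Reach.trans {m p : ℕ} {s t r : List ℤ} (h : Reach m s t) (h' : Reach p t r) :
    Reach (m + p) s r := by
  obtain ⟨ks, hk, rfl, hm⟩ := h
  obtain ⟨ks', hk', rfl, hp⟩ := h'
  refine ⟨ks ++ ks', ?_, by simp [applyFlips], by simp; omega⟩
  intro k hmem
  rcases List.mem_append.1 hmem with h | h
  · exact hk k h
  · simpa only [length_applyFlips] using hk' k h

lemma reach_flip (a b : List ℤ) : Reach 1 (a ++ b) (turnOver a ++ b) := by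
  cases a with
  | nil => exact ⟨[], by simp, by simp [applyFlips], by simp⟩
  | cons x a =>
    exact ⟨[(x :: a).length], by simp, by simp [applyFlips, pancakeFlip_eq], by simp⟩

/-- Flipping the top `p ++ q` and then the image of `q`. -/
lemma reach_two (p q b : List ℤ) : Reach 2 (p ++ q ++ b) (q ++ turnOver p ++ b) := by
  have h := (reach_flip (p ++ q) b).trans
    (by simpa using reach_flip (turnOver q) (turnOver p ++ b))
  simpa using h

lemma T_le_of_reach {n m : ℕ} (h : Reach m (burntStack n) (sortedStack n)) : T n ≤ m := by
  obtain ⟨ks, hk, hs, hm⟩ := h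
  refine le_trans (Nat.sInf_le ⟨ks, ⟨?_, hs⟩, rfl⟩) hm
  simpa [burntStack] using hk

/-! ### Substituting blocks for pancakes -/

/-- The block substituted for a signed pancake; a negative pancake yields the block turned over. -/
def signedBlock (f : ℤ → List ℤ) (z : ℤ) : List ℤ :=
  if 0 < z then f z else turnOver (if z = 0 then [] else f (-z))

lemma signedBlock_neg (f : ℤ → List ℤ) (z : ℤ) :
    signedBlock f (-z) = turnOver (signedBlock f z) := by
  rcases lt_trichotomy z 0 with h | rfl | h
  · simp [signedBlock, h, h.ne, h.not_gt]
  · simp [signedBlock]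
  · simp [signedBlock, h, h.ne', h.le]

lemma flatMap_turnOver (f : ℤ → List ℤ) (l : List ℤ) :
    (turnOver l).flatMap (signedBlock f) = turnOver (l.flatMap (signedBlock f)) := by
  induction l with
  | nil => rfl
  | cons x l ih => simp [ih, signedBlock_neg]

/-- A sequence of flips acts in the same way on a stack of blocks. -/
lemma reach_flatMap (f : ℤ → List ℤ) (ks : List ℕ) (s : List ℤ) :
    Reach ks.length (s.flatMap (signedBlock f)) ((applyFlips ks s).flatMap (signedBlock f)) := by
  induction ks generalizing s with
  | nil => exact Reach.refl _
  | cons k ks ih =>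
    have h := reach_flip ((s.take k).flatMap (signedBlock f))
      ((s.drop k).flatMap (signedBlock f))
    rw [← List.flatMap_append, List.take_append_drop, ← flatMap_turnOver,
      ← List.flatMap_append, ← pancakeFlip_eq] at h
    rw [List.length_cons, add_comm]
    exact h.trans (ih _)

/-! ### Runs -/

/-- The decreasing run of `m` integers starting at `a`. -/
def downRun (a : ℤ) (m : ℕ) : List ℤ := (List.range m).map (fun i : ℕ => a - (i : ℤ))

/-- The increasing run of `m` integers starting at `a`. -/
def upRun (a : ℤ) (m : ℕ) : List ℤ := (List.range m).map (fun i : ℕ => a + (i : ℤ))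

lemma downRun_add (a : ℤ) (m p : ℕ) :
    downRun a (m + p) = downRun a m ++ downRun (a - m) p := by
  simp [downRun, List.range_add, sub_sub]

lemma upRun_add (a : ℤ) (m p : ℕ) :
    upRun a (m + p) = upRun a m ++ upRun (a + m) p := by
  simp [upRun, List.range_add, add_assoc]

lemma turnOver_downRun (a : ℤ) (m : ℕ) : turnOver (downRun a m) = downRun (m - 1 - a) m := by
  induction m generalizing a with
  | zero => rfl
  | succ m ih =>
    rw [add_comm m 1, downRun_add, turnOver_append, ih, add_comm 1 m, downRun_add]
    simp [downRun]

lemma turnOver_upRun (a : ℤ) (m : ℕ) : turnOver (upRun a m) = upRun (1 - m - a) m := by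
  induction m generalizing a with
  | zero => rfl
  | succ m ih =>
    rw [add_comm m 1, upRun_add, turnOver_append, ih, add_comm 1 m, upRun_add,
      show 1 - (m : ℤ) - (a + (1 : ℕ)) = 1 - (m + 1 : ℕ) - a by push_cast; ring]
    simp [upRun]
    ring

lemma burntStack_eq (n : ℕ) : burntStack n = downRun (-1) n := by
  rw [downRun, ← List.flatMap_singleton' (List.map _ _), List.flatMap_map]
  simp [burntStack, List.map_flatMap, sub_eq_add_neg, add_comm]

lemma sortedStack_eq (n : ℕ) : sortedStack n = upRun 1 n := by
  rw [upRun, ← List.flatMap_singleton' (List.map _ _), List.flatMap_map]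
  simp [sortedStack, List.map_flatMap, add_comm]

lemma flatMap_downRun {g : ℤ → List ℤ} {a b : ℤ} {m : ℕ}
    (h : ∀ i : ℕ, i < m → g (a - i) = [b - i]) : (downRun a m).flatMap g = downRun b m := by
  rw [downRun, List.flatMap_map, downRun, ← List.flatMap_singleton' (List.map _ _),
    List.flatMap_map]
  exact List.flatMap_congr fun i hi => h i (List.mem_range.1 hi)

lemma flatMap_upRun {g : ℤ → List ℤ} {a b : ℤ} {m : ℕ}
    (h : ∀ i : ℕ, i < m → g (a + i) = [b + i]) : (upRun a m).flatMap g = upRun b m := by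
  rw [upRun, List.flatMap_map, upRun, ← List.flatMap_singleton' (List.map _ _),
    List.flatMap_map]
  exact List.flatMap_congr fun i hi => h i (List.mem_range.1 hi)

/-! ### Chains of pairs -/

/-- The low pairs starting at `8` and the high pairs starting at `h`, interleaved. -/
def mixedChain (h : ℤ) : ℕ → List ℤ
  | 0 => []
  | k + 1 => mixedChain h k ++ [9 + 2 * (k : ℤ), 8 + 2 * k, -(h + 2 * k), -(h + 2 * k + 1)]

/-- Every other high pair, followed by the sorted low pair which it used to separate. -/
def leftChain (h : ℤ) : ℕ → List ℤ
  | 0 => []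
  | j + 1 => leftChain h j ++ [-(h + 4 * (j : ℤ)), -(h + 4 * j + 1), 11 + 4 * j, 12 + 4 * j]

/-- The high pairs missing from `leftChain`, with the remaining sorted low pairs. -/
def rightChain (h : ℤ) : ℕ → List ℤ
  | 0 => []
  | j + 1 => [h + 4 * j + 3, h + 4 * j + 2, -(10 + 4 * j), -(9 + 4 * j)] ++ rightChain h j

/-- The interleaved chain in which all pairs are sorted. -/
def sortedChain (h : ℤ) : ℕ → List ℤ
  | 0 => []
  | k + 1 => [-(10 + 2 * (k : ℤ)), -(9 + 2 * k), h - 1 + 2 * k, h + 2 * k] ++ sortedChain h k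

lemma reach_mixedChain (h : ℤ) (k : ℕ) (q s : List ℤ) :
    Reach (2 * k) (downRun (-8) (2 * k) ++ q ++ downRun (-h) (2 * k) ++ s)
      (q ++ mixedChain h k ++ s) := by
  induction k generalizing q s with
  | zero => simpa [downRun, mixedChain] using Reach.refl (q ++ s)
  | succ k ih =>
    have h1 := ih ([-(8 + 2 * (k : ℤ)), -(9 + 2 * (k : ℤ))] ++ q)
      ([-(h + 2 * (k : ℤ)), -(h + 2 * (k : ℤ) + 1)] ++ s)
    have h2 := reach_two [-(8 + 2 * (k : ℤ)), -(9 + 2 * (k : ℤ))] (q ++ mixedChain h k)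
      ([-(h + 2 * (k : ℤ)), -(h + 2 * (k : ℤ) + 1)] ++ s)
    simp only [List.append_assoc] at h1 h2
    have hrun (a b : ℤ) (hb : b = a + 1) : downRun (-a) (2 * (k + 1)) =
        downRun (-a) (2 * k) ++ [-(a + 2 * (k : ℤ)), -(b + 2 * (k : ℤ))] := by
      subst hb
      rw [show 2 * (k + 1) = 2 * k + 2 by ring, downRun_add]
      simp [downRun, List.range_succ]
      constructor <;> ring
    rw [hrun 8 9 (by norm_num), hrun h (h + 1) rfl, show 2 * (k + 1) = 2 * k + 2 by ring]
    have h3 := h1.trans h2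
    simpa [mixedChain, add_right_comm] using h3

lemma reach_leftChain_rightChain (h : ℤ) (j : ℕ) (m t : List ℤ) :
    Reach (2 * j) ((8 + 4 * j : ℤ) :: (m ++ turnOver (mixedChain h (2 * j)) ++ t))
      (8 :: (leftChain h j ++ m ++ rightChain h j ++ t)) := by
  induction j generalizing m with
  | zero => simpa [leftChain, rightChain, mixedChain] using Reach.refl (8 :: (m ++ t))
  | succ j ih =>
    have h1 := reach_flip ([(12 + 4 * j : ℤ)] ++ m ++
        [h + 4 * (j : ℤ) + 3, h + 4 * j + 2, -(10 + 4 * j)])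
      ([-(11 + 4 * j : ℤ), h + 4 * j + 1, h + 4 * j, -(8 + 4 * j), -(9 + 4 * j)] ++
        turnOver (mixedChain h (2 * j)) ++ t)
    have h2 := reach_flip ([10 + 4 * (j : ℤ), -(h + 4 * j + 2), -(h + 4 * j + 3)] ++ turnOver m ++
        [-(12 + 4 * j : ℤ), -(11 + 4 * j), h + 4 * j + 1, h + 4 * j, -(8 + 4 * j)])
      ([-(9 + 4 * j : ℤ)] ++ turnOver (mixedChain h (2 * j)) ++ t)
    have h3 := ih ([-(h + 4 * (j : ℤ)), -(h + 4 * j + 1), 11 + 4 * j, 12 + 4 * j] ++ m ++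
      [h + 4 * (j : ℤ) + 3, h + 4 * j + 2, -(10 + 4 * j), -(9 + 4 * j)])
    simp only [turnOver_append, turnOver_cons, turnOver_nil, turnOver_turnOver, neg_neg,
      List.append_assoc, List.cons_append, List.nil_append] at h1 h2 h3
    have h4 := (h1.trans h2).trans h3
    have e : mixedChain h (2 * (j + 1)) = mixedChain h (2 * j) ++
        [9 + 4 * (j : ℤ), 8 + 4 * j, -(h + 4 * j), -(h + 4 * j + 1),
          11 + 4 * j, 10 + 4 * j, -(h + 4 * j + 2), -(h + 4 * j + 3)] := by
      rw [show 2 * (j + 1) = 2 * j + 1 + 1 by ring, mixedChain, mixedChain]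
      simp
      omega
    rw [e, show 2 * (j + 1) = 1 + 1 + 2 * j by ring,
      show (8 + 4 * (j + 1 : ℕ) : ℤ) = 12 + 4 * j by push_cast; ring]
    simpa only [leftChain, rightChain, turnOver_append, turnOver_cons, turnOver_nil, neg_neg,
      List.append_assoc, List.cons_append, List.nil_append] using h4

lemma reach_sortedChain (h : ℤ) (j : ℕ) (x z : List ℤ) :
    Reach (2 * j) (-(h - 1) :: (turnOver (rightChain h j) ++ x ++ turnOver (leftChain h j) ++ z))
      (-(h - 1 + 4 * j) :: (x ++ sortedChain h (2 * j) ++ z)) := by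
  induction j generalizing x with
  | zero => simpa [leftChain, rightChain, sortedChain] using Reach.refl (-(h - 1) :: (x ++ z))
  | succ j ih =>
    have h1 := ih (turnOver [h + 4 * (j : ℤ) + 3, h + 4 * j + 2, -(10 + 4 * j), -(9 + 4 * j)] ++
      x ++ turnOver [-(h + 4 * (j : ℤ)), -(h + 4 * j + 1), 11 + 4 * j, 12 + 4 * j])
    have h2 := reach_flip ([-(h - 1 + 4 * (j : ℤ)), 9 + 4 * j, 10 + 4 * j, -(h + 4 * j + 2),
        -(h + 4 * j + 3)] ++ x ++ [-(12 + 4 * (j : ℤ)), -(11 + 4 * j), h + 4 * j + 1])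
      ([h + 4 * (j : ℤ)] ++ sortedChain h (2 * j) ++ z)
    have h3 := reach_flip ([-(h + 4 * (j : ℤ) + 1), 11 + 4 * j, 12 + 4 * j] ++ turnOver x ++
        [h + 4 * (j : ℤ) + 3])
      ([h + 4 * (j : ℤ) + 2, -(10 + 4 * j), -(9 + 4 * j), h - 1 + 4 * j, h + 4 * j] ++
        sortedChain h (2 * j) ++ z)
    simp only [turnOver_append, turnOver_cons, turnOver_nil, turnOver_turnOver, neg_neg,
      List.append_assoc, List.cons_append, List.nil_append] at h1 h2 h3
    have h4 := (h1.trans h2).trans h3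
    have e : sortedChain h (2 * (j + 1)) =
        [-(12 + 4 * (j : ℤ)), -(11 + 4 * j), h + 4 * j + 1, h + 4 * j + 2,
          -(10 + 4 * j), -(9 + 4 * j), h - 1 + 4 * j, h + 4 * j] ++ sortedChain h (2 * j) := by
      rw [show 2 * (j + 1) = 2 * j + 1 + 1 by ring, sortedChain, sortedChain]
      simp
      omega
    rw [e, show 2 * (j + 1) = 2 * j + 1 + 1 by ring,
      show -(h - 1 + 4 * (j + 1 : ℕ)) = -(h + 4 * j + 3) by push_cast; ring]
    simpa only [leftChain, rightChain, turnOver_append, turnOver_cons, turnOver_nil, neg_neg,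
      List.append_assoc, List.cons_append, List.nil_append] using h4

lemma reach_merge (h : ℤ) (k : ℕ) (x z : List ℤ) :
    Reach (2 * k) (x ++ sortedChain h k ++ z)
      (upRun (2 - h - 2 * k) (2 * k) ++ x ++ upRun (-(8 + 2 * k)) (2 * k) ++ z) := by
  induction k generalizing x with
  | zero => simpa [upRun, sortedChain] using Reach.refl (x ++ z)
  | succ k ih =>
    have h1 := ih (x ++ [-(10 + 2 * (k : ℤ)), -(9 + 2 * k), h - 1 + 2 * k, h + 2 * k])
    have h2 := reach_flip (upRun (2 - h - 2 * k) (2 * k) ++ x ++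
        [-(10 + 2 * (k : ℤ)), -(9 + 2 * k)])
      ([h - 1 + 2 * (k : ℤ), h + 2 * k] ++ upRun (-(8 + 2 * k)) (2 * k) ++ z)
    have h3 := reach_flip (turnOver (upRun (2 - h - 2 * k) (2 * k) ++ x ++
      [-(10 + 2 * (k : ℤ)), -(9 + 2 * k)]) ++ [h - 1 + 2 * (k : ℤ), h + 2 * k])
      (upRun (-(8 + 2 * k)) (2 * k) ++ z)
    simp only [turnOver_append, turnOver_cons, turnOver_nil, turnOver_turnOver, neg_neg,
      List.append_assoc, List.cons_append, List.nil_append] at h1 h2 h3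
    have h4 := (h1.trans h2).trans h3
    have hrun (a b c : ℤ) (hb : b = a + 1) (hc : c = a + 2) :
        upRun a (2 * (k + 1)) = [a, b] ++ upRun c (2 * k) := by
      subst hb hc
      rw [show 2 * (k + 1) = 2 + 2 * k by ring, upRun_add]
      simp [upRun, List.range_succ]
    rw [hrun (2 - h - 2 * (k + 1 : ℕ)) (-(h - 1 + 2 * k)) (2 - h - 2 * k)
        (by push_cast; ring) (by push_cast; ring),
      hrun (-(8 + 2 * (k + 1 : ℕ))) (-(9 + 2 * k)) (-(8 + 2 * k))
        (by push_cast; ring) (by push_cast; ring),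
      show 2 - h - 2 * ((k + 1 : ℕ) : ℤ) = -(h + 2 * k) by push_cast; ring,
      show -(8 + 2 * ((k + 1 : ℕ) : ℤ)) = -(10 + 2 * k) by push_cast; ring,
      show 2 * (k + 1) = 2 * k + 1 + 1 by ring]
    simpa only [sortedChain, List.append_assoc, List.cons_append, List.nil_append] using h4

/-! ### Inflating a word by chains -/

/-- The shift of the pancakes of size at least `p` by `4 * u`, and of those of size at least `q`
by `8 * u`; the two symbols above `v + 12` stand for the blocks `c` and `d`. -/
def inflation (u v : ℕ) (p q : ℤ) (c d : List ℤ) (z : ℤ) : List ℤ :=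
  if z < p then [z] else if z < q then [z + 4 * u] else if z ≤ v + 12 then [z + 8 * u]
  else if z = v + 13 then c else d

lemma reach_of_words (u v : ℕ) {ks₁ ks₂ ks₃ : List ℕ} {m t x : List ℤ}
    (h₁ : applyFlips ks₁ (downRun (-8) (v + 2) ++
      (v + 13 : ℤ) :: (downRun (-(v + 10)) 3 ++ downRun 7 7)) = 8 :: (m ++ -(v + 13 : ℤ) :: t))
    (h₂ : applyFlips ks₂ (8 :: (v + 13 : ℤ) :: (m ++ (v + 14 : ℤ) :: t)) =
      -(v + 9 : ℤ) :: -(v + 14 : ℤ) :: (x ++ [-(v + 13 : ℤ), -8, -7, v + 12]))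
    (h₃ : applyFlips ks₃ (-(v + 9 : ℤ) :: (x ++ [(v + 13 : ℤ), -8, -7, v + 12])) =
      upRun (-(v + 8)) v ++ (v + 13 : ℤ) :: (upRun (-8) 8 ++ upRun (v + 9) 4))
    (hm : ∀ z ∈ m, z.natAbs ≠ 8 ∧ z.natAbs ≤ v + 12)
    (ht : ∀ z ∈ t, z.natAbs ≠ 8 ∧ z.natAbs ≤ v + 12)
    (hx : ∀ z ∈ x, z.natAbs ≠ v + 9 ∧ z.natAbs ≤ v + 12) :
    Reach (3 + 12 * u + (ks₁.length + ks₂.length + ks₃.length))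
      (burntStack (v + 12 + 8 * u)) (sortedStack (v + 12 + 8 * u)) := by
  set h : ℤ := v + 10 + 4 * u with hh
  set f₁ := signedBlock (inflation u v 8 (v + 10) (mixedChain h (2 * u)) []) with hf₁
  set f₂ := signedBlock (inflation u v 9 (v + 10) (leftChain h u) (rightChain h u)) with hf₂
  set f₃ := signedBlock (inflation u v 9 (v + 9) (sortedChain h (2 * u)) []) with hf₃
  have hf₁₂ (z : ℤ) (hz : z.natAbs ≠ 8 ∧ z.natAbs ≤ v + 12) : f₁ z = f₂ z := by
    simp only [hf₁, hf₂, signedBlock, inflation]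
    split_ifs <;> first | rfl | (exfalso; omega)
  have hf₂₃ (z : ℤ) (hz : z.natAbs ≠ v + 9 ∧ z.natAbs ≤ v + 12) : f₂ z = f₃ z := by
    simp only [hf₂, hf₃, signedBlock, inflation]
    split_ifs <;> first | rfl | (exfalso; omega)
  have g₁ (z : ℤ) (hz : 0 < z) : f₁ z = inflation u v 8 (v + 10) (mixedChain h (2 * u)) [] z :=
    if_pos hz
  have g₂ (z : ℤ) (hz : 0 < z) :
      f₂ z = inflation u v 9 (v + 10) (leftChain h u) (rightChain h u) z := if_pos hz
  have g₃ (z : ℤ) (hz : 0 < z) : f₃ z = inflation u v 9 (v + 9) (sortedChain h (2 * u)) [] z :=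
    if_pos hz
  have n₁ (z : ℤ) : f₁ (-z) = turnOver (f₁ z) := signedBlock_neg _ z
  have n₂ (z : ℤ) : f₂ (-z) = turnOver (f₂ z) := signedBlock_neg _ z
  have n₃ (z : ℤ) : f₃ (-z) = turnOver (f₃ z) := signedBlock_neg _ z
  have e₁ : (downRun (-8) (v + 2) ++ (v + 13 : ℤ) ::
      (downRun (-(v + 10)) 3 ++ downRun 7 7)).flatMap f₁ =
      downRun (-8 - 4 * u) (v + 2) ++ mixedChain h (2 * u) ++
        (downRun (-h - 4 * u) 3 ++ downRun 7 7) := by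
    rw [List.flatMap_append, List.flatMap_cons, List.flatMap_append,
      flatMap_downRun (b := -8 - 4 * u), flatMap_downRun (b := -h - 4 * u),
      flatMap_downRun (b := 7), List.append_assoc, g₁ _ (by omega)]
    · congr 2
      simp [inflation]
      omega
    · intro i hi
      rw [g₁ _ (by omega), inflation, if_pos (by omega)]
    · intro i hi
      rw [show -(v + 10 : ℤ) - i = -(v + 10 + i) by ring, n₁, g₁ _ (by omega), inflation,
        if_neg (by omega), if_neg (by omega), if_pos (by omega)]
      simp [hh]
      ring
    · intro i hi
      rw [show -8 - (i : ℤ) = -(8 + i) by ring, n₁, g₁ _ (by omega), inflation,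
        if_neg (by omega), if_pos (by omega)]
      simp
      ring
  have e₁₂ : ((8 : ℤ) :: (m ++ -(v + 13 : ℤ) :: t)).flatMap f₁ =
      (8 + 4 * u : ℤ) :: (m.flatMap f₂ ++ turnOver (mixedChain h (2 * u)) ++ t.flatMap f₂) := by
    rw [List.flatMap_cons, List.flatMap_append, List.flatMap_cons, n₁, g₁ _ (by omega),
      g₁ _ (by omega), List.flatMap_congr fun z hz => hf₁₂ z (hm z hz),
      List.flatMap_congr fun z hz => hf₁₂ z (ht z hz)]
    simp [inflation]
    split_ifs <;> first | omega | (simp [hh]; try omega)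
  have e₂ : ((8 : ℤ) :: (v + 13 : ℤ) :: (m ++ (v + 14 : ℤ) :: t)).flatMap f₂ =
      8 :: (leftChain h u ++ m.flatMap f₂ ++ rightChain h u ++ t.flatMap f₂) := by
    rw [List.flatMap_cons, List.flatMap_cons, List.flatMap_append, List.flatMap_cons,
      g₂ _ (by omega), g₂ _ (by omega), g₂ _ (by omega)]
    simp [inflation]
    split_ifs <;> first | omega | (simp [hh]; try omega)
  have e₂₃ : (-(v + 9 : ℤ) :: -(v + 14 : ℤ) ::
      (x ++ [-(v + 13 : ℤ), -8, -7, (v + 12 : ℤ)])).flatMap f₂ =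
      -(h - 1) :: (turnOver (rightChain h u) ++ x.flatMap f₃ ++ turnOver (leftChain h u) ++
        [-8, -7, (v + 12 + 8 * u : ℤ)]) := by
    rw [List.flatMap_cons, List.flatMap_cons, List.flatMap_append,
      List.flatMap_congr fun z hz => hf₂₃ z (hx z hz)]
    simp only [List.flatMap_cons, List.flatMap_nil, n₂]
    rw [g₂ _ (by omega), g₂ _ (by omega), g₂ _ (by omega), g₂ _ (by omega), g₂ _ (by omega),
      g₂ _ (by omega)]
    simp [inflation, add_assoc]
    split_ifs <;> first | omega | (simp [hh]; try omega)
  have e₃ : (-(v + 9 : ℤ) :: (x ++ [(v + 13 : ℤ), -8, -7, v + 12])).flatMap f₃ =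
      -(h - 1 + 4 * u) :: (x.flatMap f₃ ++ sortedChain h (2 * u) ++
        [-8, -7, (v + 12 + 8 * u : ℤ)]) := by
    simp only [List.flatMap_append, List.flatMap_cons, List.flatMap_nil, n₃]
    rw [g₃ _ (by omega), g₃ _ (by omega), g₃ _ (by omega), g₃ _ (by omega), g₃ _ (by omega)]
    simp [inflation, add_assoc]
    split_ifs <;> first | omega | (simp [hh]; try omega)
  have e₃' : (upRun (-(v + 8)) v ++ (v + 13 : ℤ) :: (upRun (-8) 8 ++ upRun (v + 9) 4)).flatMap f₃ =
      upRun (-(v + 8) - 4 * u) v ++ sortedChain h (2 * u) ++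
        (upRun (-8) 8 ++ upRun (v + 9 + 8 * u) 4) := by
    rw [List.flatMap_append, List.flatMap_cons, List.flatMap_append,
      flatMap_upRun (b := -(v + 8) - 4 * u), flatMap_upRun (b := -8),
      flatMap_upRun (b := v + 9 + 8 * u), List.append_assoc, g₃ _ (by omega)]
    · congr 2
      simp [inflation]
      omega
    · intro i hi
      rw [g₃ _ (by omega), inflation, if_neg (by omega), if_neg (by omega), if_pos (by omega)]
      simp
      ring
    · intro i hi
      rw [show -8 + (i : ℤ) = -(8 - i) by ring, n₃, g₃ _ (by omega), inflation,
        if_pos (by omega)]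
      simp
    · intro i hi
      rw [show -(v + 8 : ℤ) + i = -(v + 8 - i) by ring, n₃, g₃ _ (by omega), inflation,
        if_neg (by omega), if_pos (by omega)]
      simp
      ring
  have r₁ := reach_flatMap (inflation u v 8 (v + 10) (mixedChain h (2 * u)) []) ks₁
    (downRun (-8) (v + 2) ++ (v + 13 : ℤ) :: (downRun (-(v + 10)) 3 ++ downRun 7 7))
  have r₂ := reach_flatMap (inflation u v 9 (v + 10) (leftChain h u) (rightChain h u)) ks₂
    (8 :: (v + 13 : ℤ) :: (m ++ (v + 14 : ℤ) :: t))
  have r₃ := reach_flatMap (inflation u v 9 (v + 9) (sortedChain h (2 * u)) []) ks₃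
    (-(v + 9 : ℤ) :: (x ++ [(v + 13 : ℤ), -8, -7, v + 12]))
  rw [h₁, ← hf₁, e₁, e₁₂] at r₁
  rw [h₂, ← hf₂, e₂, e₂₃] at r₂
  rw [h₃, ← hf₃, e₃, e₃'] at r₃
  have r₀ := reach_two (downRun (-1) 7) (downRun (-8) (2 * (2 * u)) ++
    downRun (-8 - 4 * u) (v + 2) ++ downRun (-h) (2 * (2 * u)) ++ downRun (-h - 4 * u) 3) []
  have r₀' := reach_mixedChain h (2 * u) (downRun (-8 - 4 * u) (v + 2))
    (downRun (-h - 4 * u) 3 ++ downRun 7 7)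
  have r₄ := reach_merge h (2 * u) (upRun (-(v + 8) - 4 * u) v)
    (upRun (-8) 8 ++ upRun (v + 9 + 8 * u) 4)
  have r₄' := reach_flip (upRun (2 - h - 2 * (2 * u : ℕ)) (2 * (2 * u)) ++
      upRun (-(v + 8) - 4 * u) v ++ upRun (-(8 + 2 * (2 * u : ℕ))) (2 * (2 * u)) ++ upRun (-8) 8)
      (upRun (v + 9 + 8 * u) 4)
  rw [turnOver_downRun] at r₀
  simp only [List.append_assoc, List.append_nil] at r₀ r₀' r₁ r₂ r₃ r₄ r₄'
  have q₁ := (r₀.trans r₀').trans r₁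
  simp only [← List.append_assoc] at q₁ r₂ r₃ r₄ r₄'
  have q₂ := (q₁.trans (reach_leftChain_rightChain h u _ _)).trans r₂
  have q₃ := (q₂.trans (reach_sortedChain h u _ _)).trans r₃
  have q₄ := (q₃.trans r₄).trans r₄'
  convert q₄ using 1
  · ring
  · rw [burntStack_eq, show v + 12 + 8 * u = 7 + 2 * (2 * u) + (v + 2) + 2 * (2 * u) + 3 by ring,
      downRun_add _ _ 3, downRun_add _ _ (2 * (2 * u)), downRun_add _ _ (v + 2), downRun_add _ 7]
    refine congrArg₂ _ (congrArg₂ _ (congrArg₂ _ (congrArg₂ _ ?_ ?_) ?_) ?_) ?_ <;>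
      exact congrArg (downRun · _) (by omega)
  · rw [sortedStack_eq, show v + 12 + 8 * u = 8 + 2 * (2 * u) + v + 2 * (2 * u) + 4 by ring,
      upRun_add _ _ 4, upRun_add _ _ (2 * (2 * u)), upRun_add _ _ v, upRun_add _ 8]
    simp only [turnOver_append, turnOver_upRun, ← List.append_assoc]
    refine congrArg₂ _ (congrArg₂ _ (congrArg₂ _ (congrArg₂ _ ?_ ?_) ?_) ?_) ?_ <;>
      exact congrArg (upRun · _) (by omega)

/-- For every integer `n ≥ 29` with `n ≡ 1 (mod 4)`, there is a sorting sequence of at most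
`(3n+3)/2` flips; equivalently `T n ≤ (3n+3)/2`. -/
theorem T_le_of_one_mod_four (n : ℕ) (hn : 29 ≤ n) (hmod : n % 4 = 1) :
    T n ≤ (3 * n + 3) / 2 := by
  have hu : ∃ u, n = 9 + 12 + 8 * u ∨ n = 13 + 12 + 8 * u := ⟨(n - 21) / 8, by omega⟩
  obtain ⟨u, rfl | rfl⟩ := hu
  · refine (T_le_of_reach (reach_of_words u 9
      (ks₁ := [8, 4, 12, 21, 3, 7, 22, 17, 6, 19, 14, 5, 8, 5, 18, 11, 15])
      (ks₂ := [21, 11, 7, 19, 16]) (ks₃ := [10, 21, 17, 7, 20, 15, 4, 7])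
      (m := [-16, -15, 11, 12, -19, -20, 4, 5, -2, -1])
      (t := [18, 17, -10, -9, 3, -14, -13, -6, -7, 21])
      (x := [1, 2, 3, -14, -13, -6, -5, -4, 20, 19, -12, -11, 15, 16, 17, -10, -9])
      ?_ ?_ ?_ ?_ ?_ ?_)).trans ?_
    · decide
    · decide
    · decide
    · decide
    · decide
    · decide
    · simp only [List.length_cons, List.length_nil]
      omega
  · refine (T_le_of_reach (reach_of_words u 13
      (ks₁ := [12, 7, 4, 16, 25, 3, 7, 26, 21, 6, 23, 18, 9, 12, 8, 10, 7, 22, 13, 16, 14, 19])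
      (ks₂ := [25, 11, 7, 23, 20]) (ks₃ := [10, 25, 21, 7, 24, 19, 4, 7, 11])
      (m := [-20, -19, -18, 11, 12, 13, -17, -16, -23, -24, 4, 5, -2, -1])
      (t := [22, 21, -10, -9, 3, 14, 15, -6, -7, 25])
      (x := [1, 2, 3, 14, 15, -6, -5, -4, 24, 23, 16, 17, -13, -12, -11, 18, 19, 20, 21, -10, -9])
      ?_ ?_ ?_ ?_ ?_ ?_)).trans ?_
    · decide
    · decide
    · decide
    · decide
    · decide
    · decide
    · simp only [List.length_cons, List.length_nil]
      omega
end
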